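/- arXiv:math/0509366 — 2 statements merged into one kernel-verified Lean document; each statement's English description precedes it below -/
import Mathlib

section
/- Let E be an sc-Banach space and U ⊆ E an open subset. Assume f : U → ℝ is sc-continuous (sc⁰, where ℝ carries the constant sc-structure) and that for every m ≥ 0 the induced map fₘ := f|_{Uₘ} : Uₘ → ℝ is of class C^{m+1} (Fréchet). Then f is of class sc^∞. -/
universe u v

/-- The data of an sc-scale on an ambient real vector space `E`:
a sequence of levels (submodules of `E`) together with a norm function for each level. -/
structure ScScale (E : Type u) [AddCommGroup E] [Module ℝ E] where
  level : ℕ → Submodule ℝ E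
  lnorm : ℕ → E → ℝ

namespace ScScale

variable {E : Type u} {F : Type v} [AddCommGroup E] [Module ℝ E] [AddCommGroup F] [Module ℝ F]

/-- The axioms making an sc-scale into an sc-Banach space structure: the levels are nested,
each level norm is a genuine complete norm on its level, the inclusion of a level into
any lower level is a compact (bounded) operator, and the intersection `E∞` of all levels
is dense in every level. -/
def IsScBanach (S : ScScale E) : Prop :=
  (∀ {m n : ℕ}, m ≤ n → S.level n ≤ S.level m) ∧
  (∀ m x, 0 ≤ S.lnorm m x) ∧
  (∀ m, ∀ x ∈ S.level m, ∀ y ∈ S.level m, S.lnorm m (x + y) ≤ S.lnorm m x + S.lnorm m y) ∧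
  (∀ m (c : ℝ), ∀ x ∈ S.level m, S.lnorm m (c • x) = |c| * S.lnorm m x) ∧
  (∀ m, ∀ x ∈ S.level m, S.lnorm m x = 0 → x = 0) ∧
  (∀ m n, m ≤ n → ∃ C > (0:ℝ), ∀ x ∈ S.level n, S.lnorm m x ≤ C * S.lnorm n x) ∧
  (∀ m (u : ℕ → E), (∀ k, u k ∈ S.level m) →
      (∀ ε > (0:ℝ), ∃ K, ∀ p ≥ K, ∀ q ≥ K, S.lnorm m (u p - u q) < ε) →
      ∃ x ∈ S.level m, ∀ ε > (0:ℝ), ∃ K, ∀ p ≥ K, S.lnorm m (u p - x) < ε) ∧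
  (∀ m (u : ℕ → E), (∀ k, u k ∈ S.level (m+1)) → (∀ k, S.lnorm (m+1) (u k) ≤ 1) →
      ∃ φ : ℕ → ℕ, StrictMono φ ∧
        ∀ ε > (0:ℝ), ∃ K, ∀ p ≥ K, ∀ q ≥ K, S.lnorm m (u (φ p) - u (φ q)) < ε) ∧
  (∀ m, ∀ x ∈ S.level m, ∀ ε > (0:ℝ), ∃ y, (∀ n, y ∈ S.level n) ∧ S.lnorm m (x - y) < ε)

/-- `U` is an open subset of the sc-space: it is contained in the `0`-level and open
with respect to the level-`0` norm topology. -/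
def IsOpenIn (S : ScScale E) (U : Set E) : Prop :=
  U ⊆ (S.level 0 : Set E) ∧
  ∀ x ∈ U, ∃ ε > (0:ℝ), ∀ y ∈ (S.level 0 : Set E), S.lnorm 0 (y - x) < ε → y ∈ U

/-- The tangent scale `TE` with `(TE)ₘ = E_{m+1} ⊕ Eₘ`, realized on `E × E`. -/
def tangent (S : ScScale E) : ScScale (E × E) where
  level m := (S.level (m+1)).prod (S.level m)
  lnorm m p := S.lnorm (m+1) p.1 + S.lnorm m p.2

/-- The tangent set `TU = U₁ ⊕ E` of a set `U`. -/
def tangentSet (S : ScScale E) (U : Set E) : Set (E × E) :=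
  {p | p.1 ∈ U ∧ p.1 ∈ S.level 1 ∧ p.2 ∈ S.level 0}

/-- The shifted scale `E^k` with `(E^k)ₘ = E_{m+k}`. -/
def shift (S : ScScale E) (k : ℕ) : ScScale E where
  level m := S.level (m + k)
  lnorm m := S.lnorm (m + k)

/-- The direct sum of two sc-scales. -/
def prod (S : ScScale E) (T : ScScale F) : ScScale (E × F) where
  level m := (S.level m).prod (T.level m)
  lnorm m p := S.lnorm m p.1 + T.lnorm m p.2

end ScScale

/-- `f : U → F` is of class sc⁰: it preserves all levels and is continuous on every level
with respect to the level norms. -/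
def Sc0 {E : Type u} {F : Type v} [AddCommGroup E] [Module ℝ E] [AddCommGroup F] [Module ℝ F]
    (SE : ScScale E) (SF : ScScale F) (U : Set E) (f : E → F) : Prop :=
  ∀ m : ℕ,
    (∀ x ∈ U ∩ (SE.level m : Set E), f x ∈ SF.level m) ∧
    (∀ x ∈ U ∩ (SE.level m : Set E), ∀ ε > (0:ℝ), ∃ δ > (0:ℝ),
      ∀ y ∈ U ∩ (SE.level m : Set E),
        SE.lnorm m (y - x) < δ → SF.lnorm m (f y - f x) < ε)

/-- The tangent map `Tf(x,h) = (f(x), Df(x)h)` associated to `f` and a family of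
linearizations `Df`. -/
def Tmap {E : Type u} {F : Type v} [AddCommGroup E] [Module ℝ E] [AddCommGroup F] [Module ℝ F]
    (f : E → F) (Df : E → (E →ₗ[ℝ] F)) : E × E → F × F :=
  fun p => (f p.1, Df p.1 p.2)

/-- `Df` witnesses that `f` is of class sc¹ on `U`: at every point `x ∈ U₁` the linear
map `Df x` is bounded from level 0 to level 0 and is the sc-differential of `f` at `x`
(a Fréchet-type limit taken from level 1 into level 0), and the tangent map
`Tf : TU → TF` is sc⁰. -/
def Sc1With {E : Type u} {F : Type v} [AddCommGroup E] [Module ℝ E] [AddCommGroup F] [Module ℝ F]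
    (SE : ScScale E) (SF : ScScale F) (U : Set E) (f : E → F)
    (Df : E → (E →ₗ[ℝ] F)) : Prop :=
  (∀ x ∈ U ∩ (SE.level 1 : Set E),
    (∃ C : ℝ, ∀ h ∈ SE.level 0, SF.lnorm 0 (Df x h) ≤ C * SE.lnorm 0 h) ∧
    (∀ ε > (0:ℝ), ∃ δ > (0:ℝ), ∀ h ∈ (SE.level 1 : Set E),
      x + h ∈ U → SE.lnorm 1 h < δ →
        SF.lnorm 0 (f (x + h) - f x - Df x h) ≤ ε * SE.lnorm 1 h)) ∧
  Sc0 SE.tangent SF.tangent (SE.tangentSet U) (Tmap f Df)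

/-- `f` is of class sc¹ on `U`. -/
def IsSc1 {E : Type u} {F : Type v} [AddCommGroup E] [Module ℝ E] [AddCommGroup F] [Module ℝ F]
    (SE : ScScale E) (SF : ScScale F) (U : Set E) (f : E → F) : Prop :=
  Sc0 SE SF U f ∧ ∃ Df : E → (E →ₗ[ℝ] F), Sc1With SE SF U f Df

/-- `f` is of class sc^k on `U`, defined inductively via tangent maps. -/
def IsSck (k : ℕ) {E : Type u} {F : Type v} [AddCommGroup E] [Module ℝ E]
    [AddCommGroup F] [Module ℝ F]
    (SE : ScScale E) (SF : ScScale F) (U : Set E) (f : E → F) : Prop :=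
  match k with
  | 0 => Sc0 SE SF U f
  | k + 1 => Sc0 SE SF U f ∧ ∃ Df : E → (E →ₗ[ℝ] F), Sc1With SE SF U f Df ∧
      IsSck k SE.tangent SF.tangent (SE.tangentSet U) (Tmap f Df)

/-- The constant sc-structure on `ℝ`: every level is `ℝ` with the absolute value. -/
noncomputable def realScale : ScScale ℝ where
  level _ := ⊤
  lnorm _ x := |x|

/-- `f : Uₘ → ℝ` is of class `C^k` (Fréchet) on the level `m`, expressed through a
family of iterated derivatives `D j x`, which are `j`-multilinear maps, bounded with
respect to the level-`m` norm, with `D (j+1)` the derivative of `D j` and with the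
top derivative `D k` continuous on `Uₘ` in the operator norm. -/
def IsCkOnLevel {E : Type u} [AddCommGroup E] [Module ℝ E]
    (SE : ScScale E) (U : Set E) (m k : ℕ) (f : E → ℝ) : Prop :=
  ∃ D : ∀ j : ℕ, E → MultilinearMap ℝ (fun _ : Fin j => E) ℝ,
    (∀ x ∈ U ∩ (SE.level m : Set E), D 0 x (fun i => i.elim0) = f x) ∧
    (∀ j ≤ k, ∀ x ∈ U ∩ (SE.level m : Set E), ∃ C : ℝ,
      ∀ v : Fin j → E, (∀ i, v i ∈ SE.level m) →
        |D j x v| ≤ C * ∏ i, SE.lnorm m (v i)) ∧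
    (∀ j < k, ∀ x ∈ U ∩ (SE.level m : Set E), ∀ ε > (0:ℝ), ∃ δ > (0:ℝ),
      ∀ h ∈ (SE.level m : Set E), x + h ∈ U → SE.lnorm m h < δ →
        ∀ v : Fin j → E, (∀ i, v i ∈ SE.level m) →
          |D j (x + h) v - D j x v - D (j+1) x (Fin.cons h v)| ≤
            ε * SE.lnorm m h * ∏ i, SE.lnorm m (v i)) ∧
    (∀ x ∈ U ∩ (SE.level m : Set E), ∀ ε > (0:ℝ), ∃ δ > (0:ℝ),
      ∀ y ∈ U ∩ (SE.level m : Set E), SE.lnorm m (y - x) < δ →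
        ∀ v : Fin k → E, (∀ i, v i ∈ SE.level m) →
          |D k y v - D k x v| ≤ ε * ∏ i, SE.lnorm m (v i))

namespace ScAux

open Function Topology

/-- A normed model of one level. -/
lemma exists_model {E : Type u} [AddCommGroup E] [Module ℝ E] (S : ScScale E)
    (hS : S.IsScBanach) (m : ℕ) :
    ∃ (X : Type u) (_ : NormedAddCommGroup X) (_ : NormedSpace ℝ X) (J : X →ₗ[ℝ] E),
      (∀ x, ‖x‖ = S.lnorm m (J x)) ∧ (∀ x, J x ∈ S.level m) ∧
      ∀ y ∈ S.level m, ∃ x, J x = y := by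
  obtain ⟨-, h0, h1, h2, h3, -⟩ := hS
  let : Norm (S.level m) := ⟨fun x => S.lnorm m x⟩
  have core : NormedSpace.Core ℝ (S.level m) :=
    { norm_nonneg := fun x => h0 m x
      norm_smul := fun c x => h2 m c x x.2
      norm_triangle := fun x y => h1 m x x.2 y y.2
      norm_eq_zero_iff := fun x => by
        constructor
        · intro h
          exact Subtype.ext (h3 m x x.2 h)
        · rintro rfl
          have := h2 m 0 0 (S.level m).zero_mem
          rw [zero_smul, abs_zero, zero_mul] at this
          exact this }
  let := NormedAddCommGroup.ofCore core
  exact ⟨S.level m, inferInstance, NormedSpace.ofCore core, (S.level m).subtype,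
    fun x => rfl, fun x => x.2, fun y hy => ⟨⟨y, hy⟩, rfl⟩⟩

open Classical in
/-- Restriction of a multilinear map to a normed model. -/
noncomputable def restr {E X : Type u} [AddCommGroup E] [Module ℝ E] [NormedAddCommGroup X]
    [NormedSpace ℝ X] (J : X →ₗ[ℝ] E) {j : ℕ} (M : MultilinearMap ℝ (fun _ : Fin j => E) ℝ) :
    ContinuousMultilinearMap ℝ (fun _ : Fin j => X) ℝ :=
  if h : ∃ C : ℝ, ∀ v : Fin j → X, ‖M.compLinearMap (fun _ => J) v‖ ≤ C * ∏ i, ‖v i‖ then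
    (M.compLinearMap (fun _ => J)).mkContinuous h.choose h.choose_spec
  else 0

lemma restr_apply {E X : Type u} [AddCommGroup E] [Module ℝ E] [NormedAddCommGroup X]
    [NormedSpace ℝ X] (J : X →ₗ[ℝ] E) {j : ℕ} (M : MultilinearMap ℝ (fun _ : Fin j => E) ℝ)
    (S : ScScale E) (m : ℕ) (hn : ∀ x, ‖x‖ = S.lnorm m (J x)) (hJ : ∀ x, J x ∈ S.level m)
    (hb : ∃ C : ℝ, ∀ v : Fin j → E, (∀ i, v i ∈ S.level m) →
        |M v| ≤ C * ∏ i, S.lnorm m (v i)) (v : Fin j → X) :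
    restr J M v = M (fun i => J (v i)) := by
  have h : ∃ C : ℝ, ∀ v : Fin j → X,
      ‖M.compLinearMap (fun _ => J) v‖ ≤ C * ∏ i, ‖v i‖ := by
    obtain ⟨C, hC⟩ := hb
    refine ⟨C, fun v => ?_⟩
    have := hC (fun i => J (v i)) (fun i => hJ _)
    simpa [hn] using this
  rw [restr, dif_pos h]
  rfl

/-- Joint continuity at a level. -/
lemma term_cont {E : Type u} [AddCommGroup E] [Module ℝ E] (S : ScScale E)
    (hS : S.IsScBanach) (U : Set E) (l j : ℕ)
    (M : E → MultilinearMap ℝ (fun _ : Fin j => E) ℝ)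
    (hb : ∀ x ∈ U ∩ (S.level l : Set E), ∃ C : ℝ,
      ∀ v : Fin j → E, (∀ i, v i ∈ S.level l) → |M x v| ≤ C * ∏ i, S.lnorm l (v i))
    (hc : ∀ x ∈ U ∩ (S.level l : Set E), ∀ ε > (0:ℝ), ∃ δ > (0:ℝ),
      ∀ y ∈ U ∩ (S.level l : Set E), S.lnorm l (y - x) < δ →
        ∀ v : Fin j → E, (∀ i, v i ∈ S.level l) →
          |M y v - M x v| ≤ ε * ∏ i, S.lnorm l (v i)) :
    ∀ x ∈ U ∩ (S.level l : Set E), ∀ v : Fin j → E, (∀ i, v i ∈ S.level l) →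
    ∀ ε > (0:ℝ), ∃ δ > (0:ℝ), ∀ y ∈ U ∩ (S.level l : Set E), ∀ w : Fin j → E,
      (∀ i, w i ∈ S.level l) → S.lnorm l (y - x) < δ → (∀ i, S.lnorm l (w i - v i) < δ) →
      |M y w - M x v| < ε := by
  obtain ⟨X, _, _, J, hn, hJ, hsurj⟩ := exists_model S hS l
  intro x hx v hv ε hε
  obtain ⟨x, rfl⟩ := hsurj x hx.2
  choose v' hv' using fun i => hsurj (v i) (hv i)
  obtain rfl : (fun i => J (v' i)) = v := funext hv'
  have hr : ∀ y : X, J y ∈ U → ∀ v, restr J (M (J y)) v = M (J y) (fun i => J (v i)) :=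
    fun y hy v => restr_apply J _ S l hn hJ (hb _ ⟨hy, hJ y⟩) v
  let V : Set X := J ⁻¹' U
  have hN : ContinuousWithinAt (fun y : X => restr J (M (J y))) V x := by
    rw [Metric.continuousWithinAt_iff]
    intro ε hε
    obtain ⟨δ, hδ, h⟩ := hc _ hx (ε / 2) (half_pos hε)
    refine ⟨δ, hδ, fun {y} hy hyx => ?_⟩
    rw [dist_eq_norm] at hyx ⊢
    refine lt_of_le_of_lt ?_ (half_lt_self hε)
    refine ContinuousMultilinearMap.opNorm_le_bound (half_pos hε).le fun v => ?_
    have := h (J y) ⟨hy, hJ y⟩ (by rw [← map_sub, ← hn]; exact hyx) (fun i => J (v i))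
      (fun i => hJ _)
    simp only [← hn] at this
    rwa [sub_apply, hr y hy, hr x hx.1, Real.norm_eq_abs]
  have hN2 : ContinuousWithinAt (fun p : X × (Fin j → X) => restr J (M (J p.1)) p.2)
      (V ×ˢ Set.univ) (x, v') := by
    have h1 : ContinuousWithinAt (fun p : X × (Fin j → X) => restr J (M (J p.1)))
      (V ×ˢ Set.univ) (x, v') :=
      ContinuousWithinAt.comp (t := V) (g := fun y : X => restr J (M (J y)))
        (f := Prod.fst) hN continuous_fst.continuousWithinAt (fun p hp => hp.1)
    exact h1.eval continuous_snd.continuousWithinAt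
  rw [Metric.continuousWithinAt_iff] at hN2
  obtain ⟨δ, hδ, h⟩ := hN2 ε hε
  refine ⟨δ, hδ, fun y hy w hw hyx hwv => ?_⟩
  obtain ⟨y, rfl⟩ := hsurj y hy.2
  choose w' hw' using fun i => hsurj (w i) (hw i)
  obtain rfl : (fun i => J (w' i)) = w := funext hw'
  have := @h (y, w') ⟨hy.1, trivial⟩ (by
    rw [Prod.dist_eq, max_lt_iff]
    refine ⟨?_, ?_⟩
    · rw [dist_eq_norm, hn, map_sub]; exact hyx
    · rw [dist_pi_lt_iff hδ]
      intro i
      rw [dist_eq_norm, hn, map_sub]; exact hwv i)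
  simpa only [hr y hy.1, hr x hx.1, Real.dist_eq] using this

/-- Joint differentiability at a level. -/
lemma term_deriv {E : Type u} [AddCommGroup E] [Module ℝ E] (S : ScScale E)
    (hS : S.IsScBanach) (U : Set E) (l j : ℕ)
    (M : E → MultilinearMap ℝ (fun _ : Fin j => E) ℝ)
    (M' : E → MultilinearMap ℝ (fun _ : Fin (j+1) => E) ℝ)
    (hb : ∀ x ∈ U ∩ (S.level l : Set E), ∃ C : ℝ,
      ∀ v : Fin j → E, (∀ i, v i ∈ S.level l) → |M x v| ≤ C * ∏ i, S.lnorm l (v i))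
    (hb' : ∀ x ∈ U ∩ (S.level l : Set E), ∃ C : ℝ,
      ∀ v : Fin (j+1) → E, (∀ i, v i ∈ S.level l) → |M' x v| ≤ C * ∏ i, S.lnorm l (v i))
    (hd : ∀ x ∈ U ∩ (S.level l : Set E), ∀ ε > (0:ℝ), ∃ δ > (0:ℝ),
      ∀ h ∈ (S.level l : Set E), x + h ∈ U → S.lnorm l h < δ →
        ∀ v : Fin j → E, (∀ i, v i ∈ S.level l) →
          |M (x + h) v - M x v - M' x (Fin.cons h v)| ≤
            ε * S.lnorm l h * ∏ i, S.lnorm l (v i)) :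
    ∀ x ∈ U ∩ (S.level l : Set E), ∀ v : Fin j → E, (∀ i, v i ∈ S.level l) →
    ∀ ε > (0:ℝ), ∃ δ > (0:ℝ), ∀ h ∈ (S.level l : Set E), x + h ∈ U → ∀ w : Fin j → E,
      (∀ i, w i ∈ S.level l) → ∀ r ≥ 0, r < δ → S.lnorm l h ≤ r → (∀ i, S.lnorm l (w i) ≤ r) →
      |M (x + h) (fun i => v i + w i) - M x v -
        (M' x (Fin.cons h v) + ∑ i, M x (update v i (w i)))| ≤ ε * r := by
  obtain ⟨X, _, _, J, hn, hJ, hsurj⟩ := exists_model S hS l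
  intro x hx v hv ε hε
  obtain ⟨x, rfl⟩ := hsurj x hx.2
  choose v' hv' using fun i => hsurj (v i) (hv i)
  obtain rfl : (fun i => J (v' i)) = v := funext hv'
  have hr : ∀ y : X, J y ∈ U → ∀ v, restr J (M (J y)) v = M (J y) (fun i => J (v i)) :=
    fun y hy v => restr_apply J _ S l hn hJ (hb _ ⟨hy, hJ y⟩) v
  have hr' : ∀ y : X, J y ∈ U → ∀ v, restr J (M' (J y)) v = M' (J y) (fun i => J (v i)) :=
    fun y hy v => restr_apply J _ S l hn hJ (hb' _ ⟨hy, hJ y⟩) v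
  have hcons : ∀ (h : X) (v : Fin j → X),
      (fun i => J ((Fin.cons h v : Fin (j+1) → X) i)) =
        (Fin.cons (J h) (fun i => J (v i)) : Fin (j+1) → E) := by
    intro h v
    funext i
    refine Fin.cases ?_ (fun i => ?_) i <;> simp
  have hupd : ∀ (i : Fin j) (h : X) (v : Fin j → X),
      (fun k => J (update v i h k)) = update (fun k => J (v k)) i (J h) := by
    intro i h v
    funext k
    by_cases hk : k = i
    · subst hk; simp
    · simp [hk]
  let V : Set X := J ⁻¹' U
  have hN : HasFDerivWithinAt (fun y : X => restr J (M (J y))) (restr J (M' (J x))).curryLeft V x := by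
    rw [hasFDerivWithinAt_iff_isLittleO, Asymptotics.isLittleO_iff]
    intro ε hε
    obtain ⟨δ, hδ, h⟩ := hd _ hx ε hε
    rw [eventually_nhdsWithin_iff, Metric.eventually_nhds_iff]
    refine ⟨δ, hδ, fun y hyx hy => ?_⟩
    rw [dist_eq_norm] at hyx
    refine ContinuousMultilinearMap.opNorm_le_bound (by positivity) fun v => ?_
    have hxy : J x + J (y - x) = J y := by rw [← map_add]; congr 1; abel
    have := h (J (y - x)) (hJ _) (by rw [hxy]; exact hy) (by rw [← hn]; exact hyx)
      (fun i => J (v i)) (fun i => hJ _)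
    rw [hxy] at this
    simp only [← hn] at this
    rwa [sub_apply, sub_apply, hr y hy,
      hr x hx.1, ContinuousMultilinearMap.curryLeft_apply, hr' x hx.1, Real.norm_eq_abs, hcons]
  have hN1 : HasFDerivWithinAt (fun p : X × (Fin j → X) => restr J (M (J p.1)))
      ((restr J (M' (J x))).curryLeft ∘L ContinuousLinearMap.fst ℝ X (Fin j → X))
      (V ×ˢ Set.univ) (x, v') :=
    HasFDerivWithinAt.comp (x := ((x, v') : X × (Fin j → X))) (t := V)
      (g := fun y : X => restr J (M (J y))) (f := Prod.fst) hN
      hasFDerivWithinAt_fst (fun p hp => hp.1)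
  have hN2 := hN1.continuousMultilinearMap_apply
    (g := fun i (p : X × (Fin j → X)) => p.2 i)
    (g' := fun i => (ContinuousLinearMap.proj (R := ℝ) (φ := fun _ : Fin j => X) i) ∘L ContinuousLinearMap.snd ℝ X (Fin j → X))
    (fun i => ((ContinuousLinearMap.proj (R := ℝ) (φ := fun _ : Fin j => X) i) ∘L
      ContinuousLinearMap.snd ℝ X (Fin j → X)).hasFDerivWithinAt)
  rw [hasFDerivWithinAt_iff_isLittleO, Asymptotics.isLittleO_iff] at hN2
  have h := hN2 hε
  rw [eventually_nhdsWithin_iff, Metric.eventually_nhds_iff] at h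
  obtain ⟨δ, hδ, h⟩ := h
  refine ⟨δ, hδ, fun k hk hxk w hw r hr0 hrδ hkr hwr => ?_⟩
  obtain ⟨k, rfl⟩ := hsurj k hk
  choose w' hw' using fun i => hsurj (w i) (hw i)
  obtain rfl : (fun i => J (w' i)) = w := funext hw'
  rw [← map_add] at hxk
  have hle : ‖((k, w') : X × (Fin j → X))‖ ≤ r := by
    rw [Prod.norm_def]
    refine max_le (by rw [hn]; exact hkr) ?_
    exact (pi_norm_le_iff_of_nonneg hr0).2 fun i => by rw [hn]; exact hwr i
  have := @h (x + k, v' + w') (by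
    rw [dist_eq_norm]
    simpa using lt_of_le_of_lt hle hrδ) ⟨hxk, trivial⟩
  have e : ((x + k, v' + w') : X × (Fin j → X)) - (x, v') = (k, w') := by simp
  rw [e] at this
  have h3 := this.trans (mul_le_mul_of_nonneg_left hle hε.le)
  simp only [hr (x + k) hxk, hr x hx.1, Real.norm_eq_abs, add_apply,
    sum_apply, ContinuousLinearMap.comp_apply,
    ContinuousMultilinearMap.apply_apply, ContinuousMultilinearMap.curryLeft_apply,
    hr' x hx.1, hcons, ContinuousLinearMap.coe_fst', ContinuousLinearMap.coe_snd',
    ContinuousLinearMap.proj_apply, ContinuousMultilinearMap.toContinuousLinearMap_apply,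
    hupd, Pi.add_apply] at h3
  simpa only [map_add] using h3

/-- The analytic facts about the family of derivatives that are used below. -/
structure Jet {E : Type u} [AddCommGroup E] [Module ℝ E] (S : ScScale E) (U : Set E)
    (D : ∀ j : ℕ, E → MultilinearMap ℝ (fun _ : Fin j => E) ℝ) : Prop where
  nn : ∀ m x, 0 ≤ S.lnorm m x
  bd : ∀ j, ∀ x ∈ U ∩ (S.level (j - 1) : Set E), ∀ v : Fin j → E,
    (∀ i, v i ∈ S.level (j - 1)) → ∀ i, ∃ C : ℝ, ∀ h ∈ S.level (j - 1),
      |D j x (update v i h)| ≤ C * S.lnorm (j - 1) h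
  cont : ∀ j, ∀ x ∈ U ∩ (S.level (j - 1) : Set E), ∀ v : Fin j → E,
    (∀ i, v i ∈ S.level (j - 1)) →
    ∀ ε > (0:ℝ), ∃ δ > (0:ℝ), ∀ y ∈ U ∩ (S.level (j - 1) : Set E), ∀ w : Fin j → E,
      (∀ i, w i ∈ S.level (j - 1)) → S.lnorm (j - 1) (y - x) < δ →
      (∀ i, S.lnorm (j - 1) (w i - v i) < δ) →
      |D j y w - D j x v| < ε
  deriv : ∀ j, ∀ x ∈ U ∩ (S.level j : Set E), ∀ v : Fin j → E, (∀ i, v i ∈ S.level j) →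
    ∀ ε > (0:ℝ), ∃ δ > (0:ℝ), ∀ h ∈ (S.level j : Set E), x + h ∈ U → ∀ w : Fin j → E,
      (∀ i, w i ∈ S.level j) → ∀ r ≥ 0, r < δ → S.lnorm j h ≤ r → (∀ i, S.lnorm j (w i) ≤ r) →
      |D j (x + h) (fun i => v i + w i) - D j x v -
        (D (j+1) x (Fin.cons h v) + ∑ i, D j x (update v i (w i)))| ≤ ε * r

/-- Derivatives at consecutive levels agree. -/
lemma agree {E : Type u} [AddCommGroup E] [Module ℝ E] (S : ScScale E)
    (hS : S.IsScBanach) (U : Set E) (hU : S.IsOpenIn U) (f : E → ℝ)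
    (D : ∀ m j : ℕ, E → MultilinearMap ℝ (fun _ : Fin j => E) ℝ)
    (h0 : ∀ m, ∀ x ∈ U ∩ (S.level m : Set E), D m 0 x (fun i => i.elim0) = f x)
    (hd : ∀ m, ∀ j < m + 1, ∀ x ∈ U ∩ (S.level m : Set E), ∀ ε > (0:ℝ), ∃ δ > (0:ℝ),
      ∀ h ∈ (S.level m : Set E), x + h ∈ U → S.lnorm m h < δ →
        ∀ v : Fin j → E, (∀ i, v i ∈ S.level m) →
          |D m j (x + h) v - D m j x v - D m (j+1) x (Fin.cons h v)| ≤
            ε * S.lnorm m h * ∏ i, S.lnorm m (v i)) (m : ℕ) :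
    ∀ j ≤ m + 1, ∀ x ∈ U ∩ (S.level (m+1) : Set E), ∀ v : Fin j → E,
      (∀ i, v i ∈ S.level (m+1)) → D m j x v = D (m+1) j x v := by
  obtain ⟨hnest, hnn, -, hsm, -, hcmp, -⟩ := hS
  have hle : S.level (m+1) ≤ S.level m := hnest (Nat.le_succ m)
  intro j
  induction j with
  | zero =>
    intro _ x hx v _
    have : v = fun i => i.elim0 := Subsingleton.elim _ _
    rw [this, h0 m x ⟨hx.1, hle hx.2⟩, h0 (m+1) x hx]
  | succ j ih =>
    intro hj x hx v hv
    obtain ⟨h, w, rfl⟩ : ∃ h w, v = Fin.cons h w := ⟨v 0, Fin.tail v, (Fin.cons_self_tail v).symm⟩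
    have hh : h ∈ S.level (m+1) := by simpa using hv 0
    have hw : ∀ i, w i ∈ S.level (m+1) := fun i => by simpa using hv i.succ
    have hh0 : h ∈ S.level 0 := hnest (Nat.zero_le _) hh
    set A := D m (j+1) x (Fin.cons h w) with hA
    set B := D (m+1) (j+1) x (Fin.cons h w) with hB
    set K : ℝ := S.lnorm m h * ∏ i, S.lnorm m (w i) +
      S.lnorm (m+1) h * ∏ i, S.lnorm (m+1) (w i) with hK
    have key : ∀ ε > (0:ℝ), |A - B| ≤ ε * K := by
      intro ε hε
      obtain ⟨δ₁, hδ₁, H₁⟩ := hd m j (by omega) x ⟨hx.1, hle hx.2⟩ ε hε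
      obtain ⟨δ₂, hδ₂, H₂⟩ := hd (m+1) j (by omega) x hx ε hε
      obtain ⟨δ₀, hδ₀, H₀⟩ := hU.2 x hx.1
      have ht : ∀ l (δ : ℝ), 0 < δ → ∀ᶠ t : ℝ in 𝓝[>] 0, t * S.lnorm l h < δ := by
        intro l δ hδ
        have : Filter.Tendsto (fun t : ℝ => t * S.lnorm l h) (𝓝[>] 0) (𝓝 (0 * S.lnorm l h)) :=
          ((continuous_id.mul continuous_const).tendsto 0).mono_left nhdsWithin_le_nhds
        rw [zero_mul] at this
        exact this.eventually (gt_mem_nhds hδ)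
      obtain ⟨t, ⟨⟨ht0, ht1⟩, ht2⟩, htp⟩ := (((ht 0 δ₀ hδ₀).and (ht m δ₁ hδ₁)).and
        (ht (m+1) δ₂ hδ₂)).and self_mem_nhdsWithin |>.exists
      have htp : 0 < t := htp
      have hnorm : ∀ l, h ∈ S.level l → S.lnorm l (t • h) = t * S.lnorm l h := fun l hl => by
        rw [hsm l t h hl, abs_of_pos htp]
      have hxt : x + t • h ∈ U := by
        refine H₀ _ ?_ ?_
        · exact (S.level 0).add_mem (hU.1 hx.1) ((S.level 0).smul_mem t hh0)
        · rwa [add_sub_cancel_left, hnorm 0 hh0]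
      have hth := (S.level (m+1)).smul_mem t hh
      have E₁ := H₁ (t • h) (hle hth) hxt (by rwa [hnorm m (hle hh)]) w (fun i => hle (hw i))
      have E₂ := H₂ (t • h) hth hxt (by rwa [hnorm (m+1) hh]) w hw
      have hc : ∀ l, D l (j+1) x (Fin.cons (t • h) w) = t * D l (j+1) x (Fin.cons h w) := by
        intro l
        rw [MultilinearMap.cons_smul, smul_eq_mul]
      rw [hc, hnorm m (hle hh), ih (by omega) _ ⟨hxt, (S.level (m+1)).add_mem hx.2 hth⟩ w hw,
        ih (by omega) x hx w hw] at E₁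
      rw [hc, hnorm (m+1) hh] at E₂
      have : t * |A - B| ≤ t * (ε * K) := by
        rw [← abs_of_pos htp, ← abs_mul, abs_of_pos htp]
        rw [← hA] at E₁
        rw [← hB] at E₂
        rw [abs_le] at E₁ E₂ ⊢
        rw [hK]
        constructor <;> nlinarith [E₁.1, E₁.2, E₂.1, E₂.2]
      exact le_of_mul_le_mul_left this htp
    have hlim : Filter.Tendsto (fun ε : ℝ => ε * K) (𝓝[>] 0) (𝓝 (0 * K)) :=
      ((continuous_id.mul continuous_const).tendsto 0).mono_left nhdsWithin_le_nhds
    have h3 : |A - B| ≤ 0 * K :=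
      ge_of_tendsto hlim (Filter.eventually_of_mem self_mem_nhdsWithin fun ε hε => key ε hε)
    rw [zero_mul] at h3
    exact sub_eq_zero.1 (abs_nonpos_iff.1 h3)

lemma exists_jet {E : Type u} [AddCommGroup E] [Module ℝ E] (S : ScScale E)
    (hS : S.IsScBanach) (U : Set E) (hU : S.IsOpenIn U) (f : E → ℝ)
    (hf : Sc0 S realScale U f)
    (hCk : ∀ m : ℕ, IsCkOnLevel S U m (m + 1) f) :
    ∃ D : ∀ j : ℕ, E → MultilinearMap ℝ (fun _ : Fin j => E) ℝ,
      (∀ x ∈ U, ∀ v, D 0 x v = f x) ∧ Jet S U D := by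
  choose D h0 hb hd hc using hCk
  have hag := agree S hS U hU f D h0 hd
  have hU0 : ∀ x ∈ U, x ∈ U ∩ (S.level 0 : Set E) := fun x hx => ⟨hx, hU.1 hx⟩
  have hz : ∀ x ∈ U, ∀ v, D 0 0 x v = f x := fun x hx v => by
    rw [← h0 0 x (hU0 x hx)]; congr 1; exact Subsingleton.elim _ _
  have hnn := hS.2.1
  refine ⟨fun j => D (j - 1) j, hz, hnn, ?_, ?_, ?_⟩
  · intro j x hx v hv i
    obtain ⟨C, hC⟩ := hb (j-1) j (by omega) x hx
    refine ⟨C * ∏ k ∈ Finset.univ \ {i}, S.lnorm (j-1) (v k), fun h hh => ?_⟩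
    have := hC (update v i h) (fun k => by
      by_cases hk : k = i
      · subst hk; simpa using hh
      · simpa [hk] using hv k)
    refine this.trans (le_of_eq ?_)
    have e : (fun k => S.lnorm (j-1) (update v i h k)) =
        update (fun k => S.lnorm (j-1) (v k)) i (S.lnorm (j-1) h) := by
      funext k
      by_cases hk : k = i
      · subst hk; simp
      · simp [hk]
    rw [e, Finset.prod_update_of_mem (Finset.mem_univ i)]
    ring
  · intro j
    cases j with
    | zero =>
      intro x hx v _ ε hε
      obtain ⟨δ, hδ, H⟩ := (hf 0).2 x hx ε hε
      refine ⟨δ, hδ, fun y hy w _ hyx _ => ?_⟩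
      have := H y hy hyx
      simp only [Nat.zero_sub]
      rw [hz y hy.1, hz x hx.1]
      exact this
    | succ j =>
      exact term_cont S hS U j (j+1) (D j (j+1)) (hb j (j+1) le_rfl) (hc j)
  · intro j
    have hagj : ∀ x ∈ U ∩ (S.level j : Set E), ∀ v : Fin j → E,
      (∀ i, v i ∈ S.level j) → D (j-1) j x v = D j j x v := by
      cases j with
      | zero => intro x _ v _; rfl
      | succ j => exact hag j (j+1) le_rfl
    intro x hx v hv ε hε
    obtain ⟨δ, hδ, H⟩ := term_deriv S hS U j j (D j j) (D j (j+1)) (hb j j (by omega))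
      (hb j (j+1) le_rfl) (hd j j (by omega)) x hx v hv ε hε
    refine ⟨δ, hδ, fun h hh hxh w hw r hr hrδ h1 h2 => ?_⟩
    have := H h hh hxh w hw r hr hrδ h1 h2
    simp only [Nat.add_sub_cancel]
    rw [hagj (x + h) ⟨hxh, (S.level j).add_mem hx.2 hh⟩ _
      (fun i => (S.level j).add_mem (hv i) (hw i)), hagj x hx v hv,
      Finset.sum_congr rfl (fun i _ => hagj x hx (update v i (w i)) (fun k => by
        by_cases hk : k = i
        · subst hk; simpa using hw k
        · simpa [hk] using hv k))]
    exact this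

/-- `π` maps level `m` boundedly into level `l`. -/
def Bdd {E' : Type v} {E : Type u} [AddCommGroup E'] [Module ℝ E'] [AddCommGroup E] [Module ℝ E]
    (S' : ScScale E') (S : ScScale E) (m l : ℕ) (π : E' →ₗ[ℝ] E) : Prop :=
  (∀ x ∈ S'.level m, π x ∈ S.level l) ∧
  ∃ C > (0:ℝ), ∀ x ∈ S'.level m, S.lnorm l (π x) ≤ C * S'.lnorm m x

/-- Minimal requirements on the domain scales. -/
structure Nice {E : Type u} [AddCommGroup E] [Module ℝ E] (S : ScScale E) : Prop where
  nn : ∀ m x, 0 ≤ S.lnorm m x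
  nest : ∀ m n, m ≤ n → Bdd S S n m LinearMap.id

section
variable {E : Type u} [AddCommGroup E] [Module ℝ E] {S : ScScale E}
  {E' : Type u} [AddCommGroup E'] [Module ℝ E'] {S' : ScScale E'}

lemma Bdd.fst (hS' : Nice S') {m l : ℕ} {π : E' →ₗ[ℝ] E} (h : Bdd S' S (m+1) l π) :
    Bdd S'.tangent S m l (π ∘ₗ LinearMap.fst ℝ E' E') := by
  obtain ⟨h1, C, hC, h2⟩ := h
  refine ⟨fun x hx => h1 _ hx.1, C, hC, fun x hx => (h2 _ hx.1).trans ?_⟩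
  exact mul_le_mul_of_nonneg_left (le_add_of_nonneg_right (hS'.nn _ _)) hC.le

lemma Bdd.snd (hS' : Nice S') {m l : ℕ} {π : E' →ₗ[ℝ] E} (h : Bdd S' S m l π) :
    Bdd S'.tangent S m l (π ∘ₗ LinearMap.snd ℝ E' E') := by
  obtain ⟨h1, C, hC, h2⟩ := h
  refine ⟨fun x hx => h1 _ hx.2, C, hC, fun x hx => (h2 _ hx.2).trans ?_⟩
  exact mul_le_mul_of_nonneg_left (le_add_of_nonneg_left (hS'.nn _ _)) hC.le

lemma Nice.tangent (hS' : Nice S') : Nice S'.tangent := by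
  refine ⟨fun m x => add_nonneg (hS'.nn _ _) (hS'.nn _ _), fun m n hmn => ?_⟩
  obtain ⟨h1, C, hC, h2⟩ := hS'.nest (m+1) (n+1) (by omega)
  obtain ⟨h1', C', hC', h2'⟩ := hS'.nest m n hmn
  refine ⟨fun x hx => ⟨h1 _ hx.1, h1' _ hx.2⟩, C + C', by positivity, fun x hx => ?_⟩
  have a := h2 _ hx.1
  have b := h2' _ hx.2
  have c := hS'.nn (n+1) x.1
  have d := hS'.nn n x.2
  simp only [LinearMap.id_apply] at a b ⊢
  change S'.lnorm (m+1) x.1 + S'.lnorm m x.2 ≤ (C + C') * (S'.lnorm (n+1) x.1 + S'.lnorm n x.2)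
  nlinarith

/-- The class of functions generated by evaluations of derivatives. -/
inductive Cls (S : ScScale E) (U : Set E)
    (D : ∀ j : ℕ, E → MultilinearMap ℝ (fun _ : Fin j => E) ℝ)
    (S' : ScScale E') (U' : Set E') : (E' → ℝ) → Prop
  | zero (g : E' → ℝ) (hg : ∀ x ∈ U', g x = 0) : Cls S U D S' U' g
  | term (j : ℕ) (π : E' →ₗ[ℝ] E) (a : Fin j → (E' →ₗ[ℝ] E)) (hU : ∀ x ∈ U', π x ∈ U)
      (hπ : ∀ m l, l ≤ m + j → Bdd S' S m l π)
      (ha : ∀ i, ∀ m l, l + 1 ≤ m + j → Bdd S' S m l (a i)) (g : E' → ℝ)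
      (hg : ∀ x ∈ U', g x = D j (π x) (fun i => a i x)) : Cls S U D S' U' g
  | add (g₁ g₂ g : E' → ℝ) (h₁ : Cls S U D S' U' g₁) (h₂ : Cls S U D S' U' g₂)
      (hg : ∀ x ∈ U', g x = g₁ x + g₂ x) : Cls S U D S' U' g

variable {U : Set E} {D : ∀ j : ℕ, E → MultilinearMap ℝ (fun _ : Fin j => E) ℝ}
  {U' : Set E'} {g : E' → ℝ}

lemma Cls.sum {ι : Type*} (s : Finset ι) (G : ι → E' → ℝ)
    (h : ∀ i ∈ s, Cls S U D S' U' (G i)) : Cls S U D S' U' (fun x => ∑ i ∈ s, G i x) := by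
  classical
  induction s using Finset.induction_on with
  | empty => exact .zero _ (fun x _ => by simp)
  | insert i s hi ih =>
    refine .add (G i) (fun x => ∑ i ∈ s, G i x) _ (h i (by simp))
      (ih fun k hk => h k (by simp [hk])) (fun x _ => ?_)
    rw [Finset.sum_insert hi]

lemma Cls.fst (hS' : Nice S') (h : Cls S U D S' U' g) :
    Cls S U D S'.tangent (S'.tangentSet U') (fun p => g p.1) := by
  induction h with
  | zero g hg => exact .zero _ fun p hp => hg _ hp.1
  | term j π a hU hπ ha g hg =>
    exact .term j (π ∘ₗ LinearMap.fst ℝ E' E') (fun i => a i ∘ₗ LinearMap.fst ℝ E' E')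
      (fun p hp => hU _ hp.1) (fun m l hl => (hπ (m+1) l (by omega)).fst hS')
      (fun i m l hl => (ha i (m+1) l (by omega)).fst hS') _ (fun p hp => hg _ hp.1)
  | add g₁ g₂ g _ _ hg ih₁ ih₂ => exact .add _ _ _ ih₁ ih₂ fun p hp => hg _ hp.1

/-- a common positive lower bound -/
lemma common {ι : Type*} [Finite ι] (δ : ι → ℝ) (hδ : ∀ i, 0 < δ i) :
    ∃ d > 0, ∀ i, d ≤ δ i := by
  rcases isEmpty_or_nonempty ι with h | h
  · exact ⟨1, one_pos, fun i => (h.false i).elim⟩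
  · obtain ⟨i, hi⟩ := Finite.exists_min δ
    exact ⟨δ i, hδ i, hi⟩

/-- a common positive upper bound for the constants -/
lemma common' {ι : Type*} [Finite ι] (C : ι → ℝ) : ∃ d > 0, ∀ i, C i ≤ d := by
  rcases isEmpty_or_nonempty ι with h | h
  · exact ⟨1, one_pos, fun i => (h.false i).elim⟩
  · obtain ⟨i, hi⟩ := Finite.exists_max C
    exact ⟨max (C i) 1, by positivity, fun k => (hi k).trans (le_max_left _ _)⟩

lemma Cls.cont (hD : Jet S U D) (h : Cls S U D S' U' g) :
    ∀ x ∈ U' ∩ (S'.level 0 : Set E'), ∀ ε > (0:ℝ), ∃ δ > (0:ℝ),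
      ∀ y ∈ U' ∩ (S'.level 0 : Set E'), S'.lnorm 0 (y - x) < δ → |g y - g x| < ε := by
  induction h with
  | zero g hg =>
    intro x hx ε hε
    refine ⟨1, one_pos, fun y hy _ => ?_⟩
    rwa [hg y hy.1, hg x hx.1, sub_zero, abs_zero]
  | term j π a hU hπ ha g hg =>
    intro x hx ε hε
    obtain ⟨hπ1, C, hC, hπ2⟩ := hπ 0 (j-1) (by omega)
    have ha' : ∀ i, Bdd S' S 0 (j-1) (a i) := fun i => ha i 0 (j-1) (by have := i.2; omega)
    choose ha1 Ca hCa ha2 using ha'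
    obtain ⟨δ, hδ, H⟩ := hD.cont j (π x) ⟨hU x hx.1, hπ1 x hx.2⟩ (fun i => a i x)
      (fun i => ha1 i x hx.2) ε hε
    obtain ⟨d, hd, hd'⟩ := common (fun i => δ / Ca i) (fun i => div_pos hδ (hCa i))
    refine ⟨min d (δ / C), lt_min hd (div_pos hδ hC), fun y hy hyx => ?_⟩
    rw [hg y hy.1, hg x hx.1]
    have hmem := (S'.level 0).sub_mem hy.2 hx.2
    refine H (π y) ⟨hU y hy.1, hπ1 y hy.2⟩ (fun i => a i y) (fun i => ha1 i y hy.2) ?_ ?_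
    · rw [← map_sub]
      refine (hπ2 _ hmem).trans_lt ?_
      rw [mul_comm, ← lt_div_iff₀ hC]
      exact hyx.trans_le (min_le_right _ _)
    · intro i
      rw [← map_sub]
      refine (ha2 i _ hmem).trans_lt ?_
      rw [mul_comm, ← lt_div_iff₀ (hCa i)]
      exact hyx.trans_le ((min_le_left _ _).trans (hd' i))
  | add g₁ g₂ g _ _ hg ih₁ ih₂ =>
    intro x hx ε hε
    obtain ⟨δ₁, hδ₁, H₁⟩ := ih₁ x hx (ε/2) (half_pos hε)
    obtain ⟨δ₂, hδ₂, H₂⟩ := ih₂ x hx (ε/2) (half_pos hε)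
    refine ⟨min δ₁ δ₂, lt_min hδ₁ hδ₂, fun y hy hyx => ?_⟩
    have a := H₁ y hy (hyx.trans_le (min_le_left _ _))
    have b := H₂ y hy (hyx.trans_le (min_le_right _ _))
    rw [hg y hy.1, hg x hx.1]
    rw [abs_lt] at *
    constructor <;> linarith [a.1, a.2, b.1, b.2]

/-- Each function of the class has an sc-differential, again in the class. -/
lemma Cls.deriv (hD : Jet S U D) (hS' : Nice S') (h : Cls S U D S' U' g) :
    ∃ Dg : E' → (E' →ₗ[ℝ] ℝ),
      (∀ x ∈ U' ∩ (S'.level 1 : Set E'),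
        (∃ C : ℝ, ∀ h ∈ S'.level 0, |Dg x h| ≤ C * S'.lnorm 0 h) ∧
        (∀ ε > (0:ℝ), ∃ δ > (0:ℝ), ∀ h ∈ (S'.level 1 : Set E'),
          x + h ∈ U' → S'.lnorm 1 h < δ →
            |g (x + h) - g x - Dg x h| ≤ ε * S'.lnorm 1 h)) ∧
      Cls S U D S'.tangent (S'.tangentSet U') (fun p => Dg p.1 p.2) := by
  induction h with
  | zero g hg =>
    refine ⟨fun _ => 0, fun x hx => ⟨⟨0, fun h _ => by simp⟩, fun ε hε => ⟨1, one_pos,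
      fun h hh hxh _ => ?_⟩⟩, .zero _ fun _ _ => by simp⟩
    rw [hg _ hxh, hg _ hx.1]
    simpa using mul_nonneg hε.le (hS'.nn 1 h)
  | add g₁ g₂ g _ _ hg ih₁ ih₂ =>
    obtain ⟨A, hA, hA'⟩ := ih₁
    obtain ⟨B, hB, hB'⟩ := ih₂
    refine ⟨fun x => A x + B x, fun x hx => ⟨?_, fun ε hε => ?_⟩, .add _ _ _ hA' hB'
      fun _ _ => by simp⟩
    · obtain ⟨C, hC⟩ := (hA x hx).1
      obtain ⟨C', hC'⟩ := (hB x hx).1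
      refine ⟨C + C', fun h hh => ?_⟩
      rw [LinearMap.add_apply, add_mul]
      exact (abs_add_le _ _).trans (add_le_add (hC h hh) (hC' h hh))
    · obtain ⟨δ₁, hδ₁, H₁⟩ := (hA x hx).2 (ε/2) (half_pos hε)
      obtain ⟨δ₂, hδ₂, H₂⟩ := (hB x hx).2 (ε/2) (half_pos hε)
      refine ⟨min δ₁ δ₂, lt_min hδ₁ hδ₂, fun h hh hxh hhδ => ?_⟩
      have a := H₁ h hh hxh (hhδ.trans_le (min_le_left _ _))
      have b := H₂ h hh hxh (hhδ.trans_le (min_le_right _ _))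
      rw [hg _ hxh, hg x hx.1, LinearMap.add_apply]
      rw [abs_le] at *
      constructor <;> linarith [a.1, a.2, b.1, b.2]
  | term j π a hU hπ ha g hg =>
    let T₁ : E' → (E' →ₗ[ℝ] ℝ) := fun x =>
      ((D (j+1) (π x)).toLinearMap (Fin.cons 0 (fun i => a i x)) 0) ∘ₗ π
    let T₂ : Fin j → E' → (E' →ₗ[ℝ] ℝ) := fun i x =>
      ((D j (π x)).toLinearMap (fun i => a i x) i) ∘ₗ a i
    have hT₁ : ∀ x h, T₁ x h = D (j+1) (π x) (Fin.cons (π h) (fun i => a i x)) := by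
      intro x h
      simp [T₁, MultilinearMap.toLinearMap_apply, Fin.update_cons_zero]
    have hT₂ : ∀ i x h, T₂ i x h = D j (π x) (update (fun i => a i x) i (a i h)) :=
      fun i x h => rfl
    refine ⟨fun x => T₁ x + ∑ i, T₂ i x, fun x hx => ⟨?_, fun ε hε => ?_⟩, ?_⟩
    · obtain ⟨hπ1, C, hC, hπ2⟩ := hπ 0 j (by omega)
      have hπx : π x ∈ S.level j := (hπ 1 j (by omega)).1 x hx.2
      have hax : ∀ i, a i x ∈ S.level j := fun i => (ha i 1 j (by omega)).1 x hx.2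
      obtain ⟨C₁, hC₁⟩ := hD.bd (j+1) (π x) ⟨hU x hx.1, hπx⟩
        (Fin.cons 0 (fun i => a i x)) (fun i => by
          refine Fin.cases ?_ (fun i => ?_) i
          · simp
          · simpa using hax i) 0
      have hC₁' : ∀ h ∈ S'.level 0, |T₁ x h| ≤ |C₁| * C * S'.lnorm 0 h := by
        intro h hh
        have h1 := hC₁ (π h) (hπ1 h hh)
        have h2 := hπ2 h hh
        refine h1.trans ((mul_le_mul_of_nonneg_right (le_abs_self C₁) ?_).trans ?_)
        · exact hD.nn _ _
        · rw [mul_assoc]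
          exact mul_le_mul_of_nonneg_left h2 (abs_nonneg _)
      have hT : ∀ i, ∃ C : ℝ, ∀ h ∈ S'.level 0, |T₂ i x h| ≤ C * S'.lnorm 0 h := by
        intro i
        obtain ⟨ha1, C', hC', ha2⟩ := ha i 0 (j-1) (by have := i.2; omega)
        obtain ⟨C₂, hC₂⟩ := hD.bd j (π x) ⟨hU x hx.1, (hπ 1 (j-1) (by omega)).1 x hx.2⟩
          (fun i => a i x) (fun k => (ha k 1 (j-1) (by omega)).1 x hx.2) i
        refine ⟨|C₂| * C', fun h hh => ?_⟩
        have h1 := hC₂ (a i h) (ha1 h hh)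
        have h2 := ha2 h hh
        refine h1.trans ((mul_le_mul_of_nonneg_right (le_abs_self C₂) ?_).trans ?_)
        · exact hD.nn _ _
        · rw [mul_assoc]
          exact mul_le_mul_of_nonneg_left h2 (abs_nonneg _)
      choose C₂ hC₂ using hT
      refine ⟨|C₁| * C + ∑ i, C₂ i, fun h hh => ?_⟩
      rw [LinearMap.add_apply, LinearMap.sum_apply, add_mul, Finset.sum_mul]
      refine (abs_add_le _ _).trans (add_le_add (hC₁' h hh) ?_)
      exact (Finset.abs_sum_le_sum_abs _ _).trans (Finset.sum_le_sum fun i _ => hC₂ i h hh)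
    · obtain ⟨hπ1, C, hC, hπ2⟩ := hπ 1 j (by omega)
      have ha' : ∀ i, Bdd S' S 1 j (a i) := fun i => ha i 1 j (by omega)
      choose ha1 Ca hCa ha2 using ha'
      obtain ⟨K₀, hK₀, hK₀'⟩ := common' Ca
      set K := max K₀ C with hK
      have hKp : 0 < K := lt_max_of_lt_left hK₀
      obtain ⟨δ, hδ, H⟩ := hD.deriv j (π x) ⟨hU x hx.1, hπ1 x hx.2⟩ (fun i => a i x)
        (fun i => ha1 i x hx.2) (ε / K) (div_pos hε hKp)
      refine ⟨δ / K, div_pos hδ hKp, fun h hh hxh hhδ => ?_⟩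
      have hn := hS'.nn 1 h
      have := H (π h) (hπ1 h hh) (by rw [← map_add]; exact hU _ hxh) (fun i => a i h)
        (fun i => ha1 i h hh) (K * S'.lnorm 1 h) (by positivity)
        (by rwa [lt_div_iff₀ hKp, mul_comm] at hhδ)
        ((hπ2 h hh).trans (mul_le_mul_of_nonneg_right (le_max_right _ _) hn))
        (fun i => (ha2 i h hh).trans (mul_le_mul_of_nonneg_right
          ((hK₀' i).trans (le_max_left _ _)) hn))
      rw [← mul_assoc, div_mul_cancel₀ _ hKp.ne'] at this
      rw [hg _ hxh, hg x hx.1, LinearMap.add_apply, LinearMap.sum_apply, hT₁]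
      simpa only [hT₂, map_add] using this
    · refine .add (fun p => T₁ p.1 p.2) (fun p => ∑ i, T₂ i p.1 p.2) _ ?_ ?_
        (fun p _ => by simp [LinearMap.sum_apply])
      · refine .term (j+1) (π ∘ₗ LinearMap.fst ℝ E' E')
          (Fin.cons (π ∘ₗ LinearMap.snd ℝ E' E') (fun i => a i ∘ₗ LinearMap.fst ℝ E' E'))
          (fun p hp => hU _ hp.1) (fun m l hl => (hπ (m+1) l (by omega)).fst hS')
          (fun i m l hl => ?_) _ (fun p hp => ?_)
        · refine Fin.cases ?_ (fun i => ?_) i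
          · exact (hπ m l (by omega)).snd hS'
          · exact (ha i (m+1) l (by omega)).fst hS'
        · rw [hT₁]
          congr 1
          funext i
          refine Fin.cases ?_ (fun i => ?_) i <;> simp
      · refine Cls.sum _ _ fun i _ => ?_
        refine .term j (π ∘ₗ LinearMap.fst ℝ E' E')
          (update (fun i => a i ∘ₗ LinearMap.fst ℝ E' E') i (a i ∘ₗ LinearMap.snd ℝ E' E'))
          (fun p hp => hU _ hp.1) (fun m l hl => (hπ (m+1) l (by omega)).fst hS')
          (fun k m l hl => ?_) _ (fun p hp => ?_)
        · by_cases hk : k = i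
          · subst hk
            simpa using (ha k m l hl).snd hS'
          · simpa [hk] using (ha k (m+1) l (by omega)).fst hS'
        · rw [hT₂]
          congr 1
          funext k
          by_cases hk : k = i
          · subst hk; simp
          · simp [hk]

end

lemma sc0_of {E' F : Type*} [AddCommGroup E'] [Module ℝ E'] [AddCommGroup F] [Module ℝ F]
    (S' : ScScale E') (SF : ScScale F) (U' : Set E') (G : E' → F) (hS' : Nice S')
    {ι : Type} [Fintype ι] (e : F ≃ₗ[ℝ] (ι → ℝ)) (hl : ∀ m, SF.level m = ⊤)
    (hn : ∀ m y, SF.lnorm m y = ∑ i, |e y i|)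
    (hc : ∀ i, ∀ x ∈ U' ∩ (S'.level 0 : Set E'), ∀ ε > (0:ℝ), ∃ δ > (0:ℝ),
      ∀ y ∈ U' ∩ (S'.level 0 : Set E'), S'.lnorm 0 (y - x) < δ →
        |e (G y) i - e (G x) i| < ε) : Sc0 S' SF U' G := by
  intro m
  refine ⟨fun x _ => by rw [hl]; trivial, fun x hx ε hε => ?_⟩
  obtain ⟨h1, C, hC, h2⟩ := hS'.nest 0 m (Nat.zero_le m)
  set N : ℝ := Fintype.card ι + 1 with hN
  have hNp : 0 < N := by positivity
  have := fun i => hc i x ⟨hx.1, h1 x hx.2⟩ (ε / N) (div_pos hε hNp)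
  choose δ hδ H using this
  obtain ⟨d, hd, hd'⟩ := common δ hδ
  refine ⟨d / C, div_pos hd hC, fun y hy hyx => ?_⟩
  have hlt : S'.lnorm 0 (y - x) < d := by
    refine (h2 _ ((S'.level m).sub_mem hy.2 hx.2)).trans_lt ?_
    rwa [lt_div_iff₀ hC, mul_comm] at hyx
  rw [hn]
  have : ∑ i, |e (G y - G x) i| ≤ ∑ _i : ι, ε / N := by
    refine Finset.sum_le_sum fun i _ => ?_
    rw [map_sub, Pi.sub_apply]
    exact (H i y ⟨hy.1, h1 y hy.2⟩ (hlt.trans_le (hd' i))).le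
  refine this.trans_lt ?_
  rw [Finset.sum_const, Finset.card_univ, nsmul_eq_mul, mul_div_assoc', div_lt_iff₀ hNp]
  nlinarith

lemma main {E : Type u} [AddCommGroup E] [Module ℝ E] (S : ScScale E) (U : Set E)
    (D : ∀ j : ℕ, E → MultilinearMap ℝ (fun _ : Fin j => E) ℝ) (hD : Jet S U D) (k : ℕ) :
    ∀ (E' : Type u) [AddCommGroup E'] [Module ℝ E'] (S' : ScScale E') (U' : Set E')
      (F : Type v) [AddCommGroup F] [Module ℝ F] (SF : ScScale F) (G : E' → F)
      (ι : Type) [Fintype ι] (e : F ≃ₗ[ℝ] (ι → ℝ)),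
      Nice S' → (∀ m, SF.level m = ⊤) → (∀ m y, SF.lnorm m y = ∑ i, |e y i|) →
      (∀ i, Cls S U D S' U' (fun x => e (G x) i)) → IsSck k S' SF U' G := by
  induction k with
  | zero =>
    intro E' _ _ S' U' F _ _ SF G ι _ e hS' hl hn hG
    exact sc0_of S' SF U' G hS' e hl hn fun i => (hG i).cont hD
  | succ k ih =>
    intro E' _ _ S' U' F _ _ SF G ι _ e hS' hl hn hG
    refine ⟨sc0_of S' SF U' G hS' e hl hn fun i => (hG i).cont hD, ?_⟩
    choose Dg h1 h2 using fun i => (hG i).deriv hD hS'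
    let DG : E' → (E' →ₗ[ℝ] F) := fun x =>
      e.symm.toLinearMap ∘ₗ LinearMap.pi (fun i => Dg i x)
    have heD : ∀ x h i, e (DG x h) i = Dg i x h := by
      intro x h i
      simp [DG]
    let e' : (F × F) ≃ₗ[ℝ] (ι ⊕ ι → ℝ) :=
      (e.prodCongr e).trans (LinearEquiv.sumArrowLequivProdArrow ι ι ℝ ℝ).symm
    have hl' : ∀ m, SF.tangent.level m = ⊤ := by
      intro m
      simp [ScScale.tangent, hl]
    have e'l : ∀ y i, e' y (Sum.inl i) = e y.1 i := fun y i => rfl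
    have e'r : ∀ y i, e' y (Sum.inr i) = e y.2 i := fun y i => rfl
    have hn' : ∀ m y, SF.tangent.lnorm m y = ∑ i, |e' y i| := by
      intro m y
      simp only [Fintype.sum_sum_type, e'l, e'r]
      simp [ScScale.tangent, hn]
    have hG' : ∀ i, Cls S U D S'.tangent (S'.tangentSet U') (fun p => e' (Tmap G DG p) i) := by
      rintro (i | i)
      · simp only [e'l]
        exact (hG i).fst hS'
      · simp only [e'r, Tmap, heD]
        exact h2 i
    refine ⟨DG, ⟨fun x hx => ⟨?_, fun ε hε => ?_⟩,
      sc0_of _ _ _ _ hS'.tangent e' hl' hn' fun i => (hG' i).cont hD⟩,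
      ih _ _ _ _ _ _ _ e' hS'.tangent hl' hn' hG'⟩
    · choose C hC using fun i => (h1 i x hx).1
      refine ⟨∑ i, C i, fun h hh => ?_⟩
      rw [hn, Finset.sum_mul]
      refine Finset.sum_le_sum fun i _ => ?_
      rw [heD]
      exact hC i h hh
    · set N : ℝ := Fintype.card ι + 1 with hN
      have hNp : 0 < N := by positivity
      choose δ hδ H using fun i => (h1 i x hx).2 (ε / N) (div_pos hε hNp)
      obtain ⟨d, hd, hd'⟩ := common δ hδ
      refine ⟨d, hd, fun h hh hxh hhd => ?_⟩
      rw [hn]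
      have : ∑ i, |e (G (x + h) - G x - DG x h) i| ≤ ∑ _i : ι, ε / N * S'.lnorm 1 h := by
        refine Finset.sum_le_sum fun i _ => ?_
        rw [map_sub, map_sub, Pi.sub_apply, Pi.sub_apply, heD]
        exact H i h hh hxh (hhd.trans_le (hd' i))
      refine this.trans ?_
      rw [Finset.sum_const, Finset.card_univ, nsmul_eq_mul, ← mul_assoc]
      refine mul_le_mul_of_nonneg_right ?_ (hS'.nn 1 h)
      rw [mul_div_assoc', div_le_iff₀ hNp]
      nlinarith

end ScAux


/-- if `f : U → ℝ` is sc⁰ (with `ℝ` carrying the constant sc-structure)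
and for every `m ≥ 0` the induced map `fₘ : Uₘ → ℝ` is of class `C^{m+1}`, then `f`
is sc-smooth, i.e. of class sc^k for every `k`. -/
theorem sc_smooth_of_levelwise_Cmplus1 {E : Type u}
    [AddCommGroup E] [Module ℝ E]
    (SE : ScScale E) (hSE : SE.IsScBanach)
    (U : Set E) (hU : SE.IsOpenIn U)
    (f : E → ℝ) (hf : Sc0 SE realScale U f)
    (hCk : ∀ m : ℕ, IsCkOnLevel SE U m (m + 1) f) :
    ∀ k : ℕ, IsSck k SE realScale U f := by
  intro k
  obtain ⟨D, hD0, hD⟩ := ScAux.exists_jet SE hSE U hU f hf hCk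
  have hnice : ScAux.Nice SE :=
    ⟨hSE.2.1, fun m n hmn => ⟨fun x hx => hSE.1 hmn hx, hSE.2.2.2.2.2.1 m n hmn⟩⟩
  refine ScAux.main SE U D hD k E SE U ℝ realScale f Unit
    (LinearEquiv.funUnique Unit ℝ ℝ).symm hnice (fun _ => rfl) (fun m y => ?_) (fun i => ?_)
  · simp [realScale]
  · refine .term 0 LinearMap.id (fun i => i.elim0) (fun x hx => hx)
      (fun m l hl => hnice.nest l m hl) (fun i => i.elim0) _ (fun x hx => ?_)
    rw [LinearMap.id_apply, hD0 x hx]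
    rfl
end

section
/- Germ-Implicit Function Theorem: let f : 𝒪(V ⊕ E, 0) → (E, 0) be both sc-smooth and an sc⁰-contraction germ, f(v,u) = u − B(v,u), and let δ be the solution germ with f(v, δ(v)) = 0 given by the level-wise Banach fixed point theorem. Then δ is sc-smooth; more precisely, for every m ∈ ℕ and k ∈ ℕ there is a neighborhood of 0 in V on which δ takes values in Eₘ and the map v ↦ δ(v) ∈ Eₘ is of class C^k. In particular δ is C^∞ at the point 0. -/
universe u v

/-- A partial cone in a finite-dimensional vector space `A`: the image of
`[0,∞)^k × ℝ^{n-k}` under a linear isomorphism `ℝⁿ ≅ A`. -/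
def IsPartialCone {A : Type v} [AddCommGroup A] [Module ℝ A] (C : Set A) : Prop :=
  ∃ (n k : ℕ) (T : A ≃ₗ[ℝ] (Fin n → ℝ)), k ≤ n ∧
    C = {a : A | ∀ i : Fin n, (i : ℕ) < k → 0 ≤ T a i}

/-- The constant sc-structure on a normed space `A` (used for finite-dimensional
parameter spaces): every level is `A` with the given norm. -/
noncomputable def constScale (A : Type v) [NormedAddCommGroup A] [NormedSpace ℝ A] :
    ScScale A where
  level _ := ⊤
  lnorm _ a := ‖a‖

/-- `g : V' → Eₘ` is of class `C^k` (Fréchet) as a map from the relatively open subset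
`V'` of the finite-dimensional normed space `A` into the level `m` of the scale `SE`,
expressed through a family of iterated derivatives which are multilinear maps with
values in `Eₘ`, bounded, with `D (j+1)` the derivative of `D j`, and with continuous
top derivative. -/
def IsCkOnInto {A : Type v} {E : Type u}
    [NormedAddCommGroup A] [NormedSpace ℝ A] [AddCommGroup E] [Module ℝ E]
    (SE : ScScale E) (m k : ℕ) (V' : Set A) (g : A → E) : Prop :=
  ∃ D : ∀ j : ℕ, A → MultilinearMap ℝ (fun _ : Fin j => A) E,
    (∀ v ∈ V', D 0 v (fun i => i.elim0) = g v) ∧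
    (∀ j ≤ k, ∀ v ∈ V', (∀ w : Fin j → A, D j v w ∈ SE.level m) ∧
      ∃ C : ℝ, ∀ w : Fin j → A, SE.lnorm m (D j v w) ≤ C * ∏ i, ‖w i‖) ∧
    (∀ j < k, ∀ v ∈ V', ∀ ε > (0:ℝ), ∃ δ > (0:ℝ), ∀ h : A, v + h ∈ V' → ‖h‖ < δ →
      ∀ w : Fin j → A,
        SE.lnorm m (D j (v + h) w - D j v w - D (j+1) v (Fin.cons h w)) ≤
          ε * ‖h‖ * ∏ i, ‖w i‖) ∧
    (∀ v ∈ V', ∀ ε > (0:ℝ), ∃ δ > (0:ℝ), ∀ v' ∈ V', ‖v' - v‖ < δ →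
      ∀ w : Fin k → A, SE.lnorm m (D k v' w - D k v w) ≤ ε * ∏ i, ‖w i‖)


universe w z

namespace GIFT
open Set Filter Topology

/-- The norm axioms of a scale, without completeness, compactness, density. -/
structure Good {E : Type u} [AddCommGroup E] [Module ℝ E] (S : ScScale E) : Prop where
  nest : ∀ {m n : ℕ}, m ≤ n → S.level n ≤ S.level m
  nonneg : ∀ m x, 0 ≤ S.lnorm m x
  tri : ∀ m, ∀ x ∈ S.level m, ∀ y ∈ S.level m, S.lnorm m (x + y) ≤ S.lnorm m x + S.lnorm m y
  smul : ∀ m (c : ℝ), ∀ x ∈ S.level m, S.lnorm m (c • x) = |c| * S.lnorm m x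
  defi : ∀ m, ∀ x ∈ S.level m, S.lnorm m x = 0 → x = 0
  bdd : ∀ m n, m ≤ n → ∃ C > (0:ℝ), ∀ x ∈ S.level n, S.lnorm m x ≤ C * S.lnorm n x

section basics
variable {E : Type u} {F : Type v} [AddCommGroup E] [Module ℝ E] [AddCommGroup F] [Module ℝ F]

theorem Good.tangent {S : ScScale E} (h : Good S) : Good S.tangent where
  nest := by
    intro m n hmn x hx
    exact ⟨h.nest (Nat.succ_le_succ hmn) hx.1, h.nest hmn hx.2⟩
  nonneg m x := add_nonneg (h.nonneg _ _) (h.nonneg _ _)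
  tri m x hx y hy := by
    have h1 := h.tri (m+1) x.1 hx.1 y.1 hy.1
    have h2 := h.tri m x.2 hx.2 y.2 hy.2
    simp only [ScScale.tangent, Prod.fst_add, Prod.snd_add]
    linarith
  smul m c x hx := by
    have h1 := h.smul (m+1) c x.1 hx.1
    have h2 := h.smul m c x.2 hx.2
    simp only [ScScale.tangent, Prod.smul_fst, Prod.smul_snd]
    rw [h1, h2]; ring
  defi m x hx h0 := by
    have a1 := h.nonneg (m+1) x.1
    have a2 := h.nonneg m x.2
    simp only [ScScale.tangent] at h0
    exact Prod.ext (h.defi _ _ hx.1 (by linarith)) (h.defi _ _ hx.2 (by linarith))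
  bdd m n hmn := by
    obtain ⟨C1, hC1, h1⟩ := h.bdd (m+1) (n+1) (Nat.succ_le_succ hmn)
    obtain ⟨C2, hC2, h2⟩ := h.bdd m n hmn
    refine ⟨C1 + C2, by positivity, fun x hx => ?_⟩
    have b1 := h1 x.1 hx.1
    have b2 := h2 x.2 hx.2
    have a1 := h.nonneg (n+1) x.1
    have a2 := h.nonneg n x.2
    simp only [ScScale.tangent]
    nlinarith

theorem Good.prod {S : ScScale E} {T : ScScale F} (h : Good S) (k : Good T) :
    Good (S.prod T) where
  nest := by
    intro m n hmn x hx
    exact ⟨h.nest hmn hx.1, k.nest hmn hx.2⟩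
  nonneg m x := add_nonneg (h.nonneg _ _) (k.nonneg _ _)
  tri m x hx y hy := by
    have h1 := h.tri m x.1 hx.1 y.1 hy.1
    have h2 := k.tri m x.2 hx.2 y.2 hy.2
    simp only [ScScale.prod, Prod.fst_add, Prod.snd_add]
    linarith
  smul m c x hx := by
    have h1 := h.smul m c x.1 hx.1
    have h2 := k.smul m c x.2 hx.2
    simp only [ScScale.prod, Prod.smul_fst, Prod.smul_snd]
    rw [h1, h2]; ring
  defi m x hx h0 := by
    have a1 := h.nonneg m x.1
    have a2 := k.nonneg m x.2
    simp only [ScScale.prod] at h0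
    exact Prod.ext (h.defi _ _ hx.1 (by linarith)) (k.defi _ _ hx.2 (by linarith))
  bdd m n hmn := by
    obtain ⟨C1, hC1, h1⟩ := h.bdd m n hmn
    obtain ⟨C2, hC2, h2⟩ := k.bdd m n hmn
    refine ⟨C1 + C2, by positivity, fun x hx => ?_⟩
    have b1 := h1 x.1 hx.1
    have b2 := h2 x.2 hx.2
    have a1 := h.nonneg n x.1
    have a2 := k.nonneg n x.2
    simp only [ScScale.prod]
    nlinarith

theorem good_const (A : Type v) [NormedAddCommGroup A] [NormedSpace ℝ A] :
    Good (constScale A) where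
  nest := fun _ _ h => h
  nonneg m x := norm_nonneg _
  tri m x _ y _ := norm_add_le _ _
  smul m c x _ := by simp [constScale, norm_smul]
  defi m x _ h0 := by simpa [constScale] using h0
  bdd m n _ := ⟨1, one_pos, fun x _ => by simp [constScale]⟩

theorem good_of_banach {S : ScScale E} (h : S.IsScBanach) : Good S where
  nest := h.1
  nonneg := h.2.1
  tri := h.2.2.1
  smul := h.2.2.2.1
  defi := h.2.2.2.2.1
  bdd := h.2.2.2.2.2.1

/-- Level `m` of a scale as a normed space. -/
def Lev (S : ScScale E) (_h : Good S) (m : ℕ) : Type u := S.level m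

variable {S : ScScale E} {hS : Good S} {T : ScScale F} {hT : Good T} {m n : ℕ}

instance : AddCommGroup (Lev S hS m) := inferInstanceAs (AddCommGroup (S.level m))
instance : Module ℝ (Lev S hS m) := inferInstanceAs (Module ℝ (S.level m))
instance : Norm (Lev S hS m) := ⟨fun x => S.lnorm m x.1⟩

theorem lev_core : NormedSpace.Core ℝ (Lev S hS m) where
  norm_nonneg x := hS.nonneg _ _
  norm_smul c x := hS.smul m c x.1 x.2
  norm_triangle x y := hS.tri m x.1 x.2 y.1 y.2
  norm_eq_zero_iff x := by
    constructor
    · intro h; exact Subtype.ext (hS.defi m x.1 x.2 h)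
    · rintro rfl
      have h := hS.smul m 0 0 (zero_mem _)
      rw [zero_smul, abs_zero, zero_mul] at h
      exact h

noncomputable instance : NormedAddCommGroup (Lev S hS m) := NormedAddCommGroup.ofCore lev_core
noncomputable instance : NormedSpace ℝ (Lev S hS m) := NormedSpace.ofCore lev_core

/-- Underlying element. -/
def Lev.v (x : Lev S hS m) : E := x.1

theorem Lev.mem (x : Lev S hS m) : x.v ∈ S.level m := x.2
theorem Lev.ext {x y : Lev S hS m} (h : x.v = y.v) : x = y := Subtype.ext h
theorem Lev.norm_def (x : Lev S hS m) : ‖x‖ = S.lnorm m x.v := rfl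
@[simp] theorem Lev.v_add (x y : Lev S hS m) : (x + y).v = x.v + y.v := rfl
@[simp] theorem Lev.v_sub (x y : Lev S hS m) : (x - y).v = x.v - y.v := rfl
@[simp] theorem Lev.v_neg (x : Lev S hS m) : (-x).v = -x.v := rfl
@[simp] theorem Lev.v_smul (c : ℝ) (x : Lev S hS m) : (c • x).v = c • x.v := rfl
@[simp] theorem Lev.v_zero : (0 : Lev S hS m).v = 0 := rfl

/-- Build a level element. -/
def mkL (hS : Good S) {m : ℕ} (x : E) (h : x ∈ S.level m) : Lev S hS m := ⟨x, h⟩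
@[simp] theorem mkL_v (x : E) (h : x ∈ S.level m) : (mkL hS x h).v = x := rfl

open Classical in
/-- Total version of `mkL`. -/
noncomputable def toLev (hS : Good S) (m : ℕ) (x : E) : Lev S hS m :=
  if h : x ∈ S.level m then ⟨x, h⟩ else 0

theorem toLev_v {x : E} (h : x ∈ S.level m) : (toLev hS m x).v = x := by
  simp [toLev, h, Lev.v]

/-- `L` is bounded from level `m` to level `n`. -/
def LB (S : ScScale E) (m : ℕ) (T : ScScale F) (n : ℕ) (L : E →ₗ[ℝ] F) : Prop :=
  (∀ x ∈ S.level m, L x ∈ T.level n) ∧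
    ∃ C : ℝ, ∀ x ∈ S.level m, T.lnorm n (L x) ≤ C * S.lnorm m x

/-- The induced continuous linear map. -/
noncomputable def levMap (hS : Good S) (hT : Good T) {L : E →ₗ[ℝ] F} (h : LB S m T n L) :
    Lev S hS m →L[ℝ] Lev T hT n :=
  LinearMap.mkContinuousOfExistsBound
    { toFun := fun x => mkL hT (L x.v) (h.1 _ x.mem)
      map_add' := fun x y => Lev.ext (by simp)
      map_smul' := fun c x => Lev.ext (by simp) }
    (by obtain ⟨C, hC⟩ := h.2; exact ⟨C, fun x => hC _ x.mem⟩)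

@[simp] theorem levMap_v {L : E →ₗ[ℝ] F} (h : LB S m T n L) (x : Lev S hS m) :
    (levMap hS hT h x).v = L x.v := rfl

theorem lb_id (hS : Good S) (h : m ≤ n) : LB S n S m (LinearMap.id) :=
  ⟨fun x hx => hS.nest h hx, by
    obtain ⟨C, _, hC⟩ := hS.bdd m n h
    exact ⟨C, hC⟩⟩

/-- Inclusion of levels. -/
noncomputable def incl (hS : Good S) (h : m ≤ n) : Lev S hS n →L[ℝ] Lev S hS m :=
  levMap hS hS (lb_id hS h)

@[simp] theorem incl_v (h : m ≤ n) (x : Lev S hS n) : (incl hS h x).v = x.v := rfl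

theorem incl_inj (h : m ≤ n) : Function.Injective (incl hS h) := fun x y hxy =>
  Lev.ext (by simpa using congrArg Lev.v hxy)

theorem lnorm_zero (hS : Good S) : S.lnorm m 0 = 0 := by
  have := hS.smul m 0 0 (zero_mem _)
  simpa using this

theorem lb_inl (hS : Good S) (m : ℕ) : LB S (m+1) S.tangent m (LinearMap.inl ℝ E E) :=
  ⟨fun x hx => ⟨hx, zero_mem _⟩, 1, fun x hx => by
    simp [ScScale.tangent, lnorm_zero hS]⟩

theorem lb_inr (hS : Good S) (m : ℕ) : LB S m S.tangent m (LinearMap.inr ℝ E E) :=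
  ⟨fun x hx => ⟨zero_mem _, hx⟩, 1, fun x hx => by
    simp [ScScale.tangent, lnorm_zero hS]⟩

theorem lb_snd (hS : Good S) (m : ℕ) : LB S.tangent m S m (LinearMap.snd ℝ E E) :=
  ⟨fun x hx => hx.2, 1, fun x hx => by
    simpa [ScScale.tangent] using hS.nonneg _ _⟩

theorem LB.comp {G : Type w} [AddCommGroup G] [Module ℝ G] {R : ScScale G} {p : ℕ}
    {L : E →ₗ[ℝ] F} {M : F →ₗ[ℝ] G}
    (hS : Good S) (hT : Good T) (hR : Good R) (hM : LB T n R p M) (hL : LB S m T n L) :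
    LB S m R p (M ∘ₗ L) :=
  ⟨fun x hx => hM.1 _ (hL.1 x hx), ‖(levMap hT hR hM).comp (levMap hS hT hL)‖, fun x hx => by
    exact ((levMap hT hR hM).comp (levMap hS hT hL)).le_opNorm (mkL hS x hx)⟩

/-- Any set-level bound from a continuity at zero. -/
theorem lb_of_cont {L : E →ₗ[ℝ] F} (hS : Good S) (hT : Good T)
    (h : ∀ x ∈ S.level m, L x ∈ T.level n)
    (hc : ∃ δ > (0:ℝ), ∀ x ∈ S.level m, S.lnorm m x < δ → T.lnorm n (L x) < 1) :
    LB S m T n L := by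
  refine ⟨h, ?_⟩
  obtain ⟨δ, hδ, hb⟩ := hc
  let L' : Lev S hS m →ₗ[ℝ] Lev T hT n :=
    { toFun := fun x => mkL hT (L x.v) (h _ x.mem)
      map_add' := fun x y => Lev.ext (by simp)
      map_smul' := fun c x => Lev.ext (by simp) }
  refine ⟨2 / δ, fun x hx => ?_⟩
  by_cases h0 : S.lnorm m x = 0
  · have : x = 0 := hS.defi m x hx h0
    subst this
    simp [lnorm_zero hS, lnorm_zero hT]
  have hp : 0 < S.lnorm m x := lt_of_le_of_ne (hS.nonneg _ _) (Ne.symm h0)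
  set c : ℝ := δ / (2 * S.lnorm m x) with hc
  have hcpos : 0 < c := by positivity
  have h1 := hb (c • x) (Submodule.smul_mem _ _ hx) (by
    rw [hS.smul m c x hx, abs_of_pos hcpos, hc]; field_simp; linarith)
  rw [map_smul, hT.smul n c _ (h x hx), abs_of_pos hcpos] at h1
  have : T.lnorm n (L x) < 1 / c := by rw [lt_div_iff₀ hcpos]; linarith
  refine this.le.trans (le_of_eq ?_)
  rw [hc]; field_simp

end basics

/-- Lifting of differentiability to a stronger norm. -/
theorem lift_deriv {D X Y : Type*} [NormedAddCommGroup D] [NormedSpace ℝ D]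
    [NormedAddCommGroup X] [NormedSpace ℝ X] [CompleteSpace X]
    [NormedAddCommGroup Y] [NormedSpace ℝ Y] [CompleteSpace Y]
    (ι : X →L[ℝ] Y) (hι : Function.Injective ι) {s : Set D} (hs : Convex ℝ s)
    {g : D → X} {g' : D → D →L[ℝ] X} (hc : ContinuousOn g' s)
    (hd : ∀ x ∈ s, HasFDerivWithinAt (fun y => ι (g y)) (ι.comp (g' x)) s x) :
    ∀ x ∈ s, HasFDerivWithinAt g (g' x) s x := by
  intro x hx
  have key : ∀ y ∈ s, g y - g x = ∫ t in (0:ℝ)..1, g' (x + t • (y - x)) (y - x) := by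
    intro y hy
    have hmem : ∀ t ∈ Icc (0:ℝ) 1, x + t • (y - x) ∈ s := fun t ht =>
      hs.add_smul_sub_mem hx hy ht
    have hcont : ContinuousOn (fun t : ℝ => g' (x + t • (y - x)) (y - x)) (Icc 0 1) := by
      refine ContinuousOn.clm_apply ?_ continuousOn_const
      exact hc.comp (by fun_prop) hmem
    have hInt : IntervalIntegrable (fun t : ℝ => g' (x + t • (y - x)) (y - x))
        MeasureTheory.volume 0 1 := by
      apply ContinuousOn.intervalIntegrable
      rwa [uIcc_of_le zero_le_one]
    apply hι
    rw [← ContinuousLinearMap.intervalIntegral_comp_comm ι hInt, map_sub]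
    have hder : ∀ t ∈ Icc (0:ℝ) 1, HasDerivWithinAt (fun t : ℝ => ι (g (x + t • (y - x))))
        (ι (g' (x + t • (y - x)) (y - x))) (Icc 0 1) t := by
      intro t ht
      have h1 : HasDerivWithinAt (fun t : ℝ => x + t • (y - x)) (y - x) (Icc 0 1) t := by
        have := ((hasDerivAt_id t).smul_const (y - x)).const_add x
        simpa using this.hasDerivWithinAt
      have := (hd _ (hmem t ht)).comp_hasDerivWithinAt t h1 hmem
      exact this
    rw [intervalIntegral.integral_eq_sub_of_hasDeriv_right_of_le zero_le_one
      (f := fun t : ℝ => ι (g (x + t • (y - x))))]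
    · simp
    · exact fun t ht => (hder t ht).continuousWithinAt
    · intro t ht
      refine ((hder t (Ioo_subset_Icc_self ht)).hasDerivAt (Icc_mem_nhds ht.1 ht.2)).hasDerivWithinAt
    · apply ContinuousOn.intervalIntegrable
      rw [uIcc_of_le zero_le_one]
      exact ι.continuous.comp_continuousOn hcont
  rw [hasFDerivWithinAt_iff_isLittleO, Asymptotics.isLittleO_iff]
  intro ε hε
  have hcx := Metric.continuousWithinAt_iff.1 (hc x hx) ε hε
  obtain ⟨r, hr, hrb⟩ := hcx
  filter_upwards [self_mem_nhdsWithin, mem_nhdsWithin_of_mem_nhds (Metric.ball_mem_nhds x hr)]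
    with y hy hyr
  have hmem : ∀ t ∈ Icc (0:ℝ) 1, x + t • (y - x) ∈ s := fun t ht =>
    hs.add_smul_sub_mem hx hy ht
  have hcont : ContinuousOn (fun t : ℝ => g' (x + t • (y - x)) (y - x)) (Icc 0 1) := by
    refine ContinuousOn.clm_apply ?_ continuousOn_const
    exact hc.comp (by fun_prop) hmem
  have hInt : IntervalIntegrable (fun t : ℝ => g' (x + t • (y - x)) (y - x))
      MeasureTheory.volume 0 1 := by
    apply ContinuousOn.intervalIntegrable
    rwa [uIcc_of_le zero_le_one]
  have e1 : g y - g x - g' x (y - x)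
      = ∫ t in (0:ℝ)..1, (g' (x + t • (y - x)) (y - x) - g' x (y - x)) := by
    rw [intervalIntegral.integral_sub hInt (by simp), ← key y hy]
    simp
  rw [e1]
  have := intervalIntegral.norm_integral_le_of_norm_le_const (a := 0) (b := 1)
    (C := ε * ‖y - x‖)
    (f := fun t : ℝ => g' (x + t • (y - x)) (y - x) - g' x (y - x)) ?_
  · simpa using this
  intro t ht
  rw [uIoc_of_le zero_le_one] at ht
  have ht' : t ∈ Icc (0:ℝ) 1 := ⟨ht.1.le, ht.2⟩
  have h2 : dist (x + t • (y - x)) x < r := by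
    rw [dist_eq_norm, add_sub_cancel_left, norm_smul, Real.norm_of_nonneg ht.1.le]
    rw [Metric.mem_ball, dist_eq_norm] at hyr
    nlinarith [norm_nonneg (y - x), ht.2]
  have h3 := hrb (hmem t ht') h2
  rw [dist_eq_norm] at h3
  calc ‖g' (x + t • (y - x)) (y - x) - g' x (y - x)‖
      = ‖(g' (x + t • (y - x)) - g' x) (y - x)‖ := by simp only [sub_apply]
    _ ≤ ‖g' (x + t • (y - x)) - g' x‖ * ‖y - x‖ := ContinuousLinearMap.le_opNorm _ _
    _ ≤ ε * ‖y - x‖ := by gcongr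

end GIFT


namespace GIFT
open Set Filter Topology

section bridge
variable {E : Type u} {F : Type v} [AddCommGroup E] [Module ℝ E] [AddCommGroup F] [Module ℝ F]
variable {S : ScScale E} {hS : Good S} {T : ScScale F} {hT : Good T} {m n : ℕ}
variable {U : Set E} {Φ : E → F} {DΦ : E → (E →ₗ[ℝ] F)}

theorem sc0_cont (hS : Good S) (hT : Good T) (h0 : Sc0 S T U Φ) (m : ℕ) :
    ContinuousOn (fun y : Lev S hS m => toLev hT m (Φ y.v)) {y | y.v ∈ U} := by
  intro x hx
  rw [Metric.continuousWithinAt_iff]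
  intro ε hε
  obtain ⟨δ, hδ, h⟩ := (h0 m).2 x.v ⟨hx, x.mem⟩ ε hε
  refine ⟨δ, hδ, fun {y} hy hd => ?_⟩
  have := h y.v ⟨hy, y.mem⟩ (by rw [dist_eq_norm] at hd; exact hd)
  rw [dist_eq_norm, Lev.norm_def, Lev.v_sub, toLev_v ((h0 m).1 _ ⟨hx, x.mem⟩),
    toLev_v ((h0 m).1 _ ⟨hy, y.mem⟩)]
  exact this

theorem sc1_mem (hS : Good S) (h1 : Sc1With S T U Φ DΦ) {x h : E} (hxU : x ∈ U)
    (hx : x ∈ S.level (m+1)) (hh : h ∈ S.level m) : DΦ x h ∈ T.level m :=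
  ((h1.2 m).1 (x, h) ⟨⟨hxU, hS.nest (by omega) hx, hS.nest (by omega) hh⟩, hx, hh⟩).2

theorem sc1_lb (hS : Good S) (hT : Good T) (h1 : Sc1With S T U Φ DΦ) {x : E} (hxU : x ∈ U)
    (hx : x ∈ S.level (m+1)) : LB S m T m (DΦ x) := by
  refine lb_of_cont hS hT (fun h hh => sc1_mem hS h1 hxU hx hh) ?_
  have hin : ∀ h ∈ S.level m, (x, h) ∈ S.tangentSet U ∩ (S.tangent.level m : Set (E × E)) :=
    fun h hh => ⟨⟨hxU, hS.nest (by omega) hx, hS.nest (by omega) hh⟩, hx, hh⟩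
  obtain ⟨δ, hδ, hb⟩ := (h1.2 m).2 (x, 0) (hin 0 (zero_mem _)) 1 one_pos
  refine ⟨δ, hδ, fun h hh hlt => ?_⟩
  have := hb (x, h) (hin h hh) (by
    simpa [ScScale.tangent, lnorm_zero hS] using hlt)
  simpa [ScScale.tangent, lnorm_zero hT, Tmap] using this

theorem sc1_cont (hS : Good S) (hT : Good T) (h1 : Sc1With S T U Φ DΦ) (m : ℕ) :
    ContinuousOn (fun p : Lev S hS (m+1) × Lev S hS m => toLev hT m (DΦ p.1.v p.2.v))
      {p | p.1.v ∈ U} := by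
  have hc := sc0_cont hS.tangent hT.tangent h1.2 m
  let j : Lev S hS (m+1) × Lev S hS m → Lev S.tangent hS.tangent m := fun p =>
    levMap hS hS.tangent (lb_inl hS m) p.1 + levMap hS hS.tangent (lb_inr hS m) p.2
  have hjv : ∀ p, (j p).v = (p.1.v, p.2.v) := fun p => by simp [j]
  have hj : Continuous j := by fun_prop
  have hmaps : MapsTo j {p | p.1.v ∈ U} {y | y.v ∈ S.tangentSet U} := fun p hp => by
    change (j p).v ∈ S.tangentSet U
    rw [hjv]
    exact ⟨hp, hS.nest (by omega) p.1.mem, hS.nest (by omega) p.2.mem⟩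
  have h2 := (levMap hT.tangent hT (lb_snd hT m)).continuous.comp_continuousOn
    (hc.comp hj.continuousOn hmaps)
  refine h2.congr fun p hp => ?_
  apply Lev.ext
  have hm := hmaps hp
  rw [toLev_v (sc1_mem hS h1 hp p.1.mem p.2.mem)]
  simp only [Function.comp, levMap_v]
  rw [toLev_v ((h1.2 m).1 _ ⟨hm, (j p).mem⟩), hjv]
  rfl

theorem sc1_deriv (hS : Good S) (hT : Good T) (h0 : Sc0 S T U Φ) (h1 : Sc1With S T U Φ DΦ)
    (x : Lev S hS 1) (hx : x.v ∈ U) :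
    HasFDerivWithinAt (fun y : Lev S hS 1 => toLev hT 0 (Φ y.v))
      ((levMap hS hT (sc1_lb (m := 0) hS hT h1 hx x.mem)).comp (incl hS (Nat.zero_le 1)))
      {y | y.v ∈ U} x := by
  rw [hasFDerivWithinAt_iff_isLittleO, Asymptotics.isLittleO_iff]
  intro ε hε
  obtain ⟨δ, hδ, hb⟩ := (h1.1 x.v ⟨hx, x.mem⟩).2 ε hε
  filter_upwards [self_mem_nhdsWithin, mem_nhdsWithin_of_mem_nhds (Metric.ball_mem_nhds x hδ)]
    with y hy hyr
  have := hb (y - x).v (y - x).mem (by simpa using hy) (by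
    rw [Metric.mem_ball, dist_eq_norm] at hyr; exact hyr)
  rw [Lev.norm_def, Lev.norm_def]
  simp only [Lev.v_sub, ContinuousLinearMap.comp_apply, levMap_v, incl_v]
  rw [toLev_v ((h0 0).1 _ ⟨hx, hS.nest (by omega) x.mem⟩),
    toLev_v ((h0 0).1 _ ⟨hy, hS.nest (by omega) y.mem⟩)]
  simpa using this

open Classical in
/-- Chain rule along finite-dimensional families. -/
theorem chain {H : Type w} [AddCommGroup H] [Module ℝ H] {R : ScScale H} (hS : Good S)
    (hT : Good T) (hR : Good R) (hcR : ∀ m, CompleteSpace (Lev R hR m))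
    {pr : F →ₗ[ℝ] H} (hpr : ∀ m, LB T m R m pr)
    (h0 : Sc0 S T U Φ) (h1 : Sc1With S T U Φ DΦ)
    {D : Type*} [NormedAddCommGroup D] [NormedSpace ℝ D] [FiniteDimensional ℝ D]
    {W : Set D} (hW : Convex ℝ W) {g : D → Lev S hS (m+1)} {g' : D → D →L[ℝ] Lev S hS (m+1)}
    (hg : ∀ x ∈ W, HasFDerivWithinAt g (g' x) W x) (hg' : ContinuousOn g' W)
    (hU : ∀ x ∈ W, (g x).v ∈ U) :
    ∃ G' : D → D →L[ℝ] Lev R hR m,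
      (∀ x ∈ W, ∀ d, (G' x d).v = pr (DΦ (g x).v (g' x d).v)) ∧ ContinuousOn G' W ∧
      ∀ x ∈ W, HasFDerivWithinAt (fun y => toLev hR m (pr (Φ (g y).v))) (G' x) W x := by
  let G' : D → D →L[ℝ] Lev R hR m := fun x =>
    if h : (g x).v ∈ U then
      (levMap hT hR (hpr m)).comp ((levMap hS hT (sc1_lb hS hT h1 h (g x).mem)).comp
        ((incl hS (Nat.le_succ m)).comp (g' x)))
    else 0
  have hG' : ∀ x ∈ W, ∀ d, (G' x d).v = pr (DΦ (g x).v (g' x d).v) := by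
    intro x hx d
    simp [G', hU x hx]
  have hmem : ∀ x ∈ W, ∀ k ≤ m + 1, Φ (g x).v ∈ T.level k := fun x hx k hk =>
    (h0 k).1 _ ⟨hU x hx, hS.nest hk (g x).mem⟩
  have hgc : ContinuousOn g W := fun x hx => (hg x hx).continuousWithinAt
  have hcont : ContinuousOn G' W := by
    rw [continuousOn_clm_apply]
    intro d
    have h2 : ContinuousOn (fun x => (g x, incl hS (Nat.le_succ m) (g' x d))) W :=
      hgc.prodMk ((incl hS (Nat.le_succ m)).continuous.comp_continuousOn
        (hg'.clm_apply continuousOn_const))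
    have h3 := (levMap hT hR (hpr m)).continuous.comp_continuousOn
      ((sc1_cont hS hT h1 m).comp h2 hU)
    refine h3.congr fun x hx => Lev.ext ?_
    rw [hG' x hx]
    simp only [Function.comp, levMap_v, incl_v]
    rw [toLev_v (sc1_mem hS h1 (hU x hx) (g x).mem (hS.nest (Nat.le_succ m) (g' x d).mem))]
  refine ⟨G', hG', hcont, ?_⟩
  refine lift_deriv (incl hR (Nat.zero_le m)) (incl_inj _) hW hcont fun x hx => ?_
  have d1 := (incl hS (show 1 ≤ m + 1 by omega)).hasFDerivAt.comp_hasFDerivWithinAt x (hg x hx)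
  have d2 := (sc1_deriv hS hT h0 h1 (incl hS (show 1 ≤ m + 1 by omega) (g x))
    (hU x hx)).comp x d1 (fun y hy => hU y hy)
  have d3 := (levMap hT hR (hpr 0)).hasFDerivAt.comp_hasFDerivWithinAt x d2
  have e : ∀ y ∈ W, incl hR (Nat.zero_le m) (toLev hR m (pr (Φ (g y).v))) =
      levMap hT hR (hpr 0) (toLev hT 0 (Φ (g y).v)) := by
    intro y hy
    apply Lev.ext
    rw [incl_v, levMap_v, toLev_v (hmem y hy 0 (by omega)),
      toLev_v ((hpr m).1 _ (hmem y hy m (by omega)))]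
  refine (d3.congr e (e x hx)).congr_fderiv ?_
  ext d
  apply Lev.ext
  simp [hG' x hx d]

end bridge
end GIFT


namespace GIFT
set_option linter.unusedSectionVars false
open Set Filter Topology

/-- Small part of the parameter set. -/
def Vb {A : Type z} [NormedAddCommGroup A] (V : Set A) (ε : ℝ) : Set A := V ∩ Metric.ball 0 ε

section main
variable {A : Type z} [NormedAddCommGroup A] [NormedSpace ℝ A]
variable {E : Type u} {F : Type v} [AddCommGroup E] [Module ℝ E] [AddCommGroup F] [Module ℝ F]
variable {H : Type w} [AddCommGroup H] [Module ℝ H]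

theorem Vb_mono {V : Set A} {a b : ℝ} (h : a ≤ b) : Vb V a ⊆ Vb V b :=
  inter_subset_inter_right _ (Metric.ball_subset_ball h)

theorem Vb_zero {V : Set A} (h0 : (0:A) ∈ V) {ε : ℝ} (h : 0 < ε) : (0:A) ∈ Vb V ε :=
  ⟨h0, Metric.mem_ball_self h⟩

theorem Vb_convex {V : Set A} (h : Convex ℝ V) (ε : ℝ) : Convex ℝ (Vb V ε) :=
  h.inter (convex_ball _ _)

theorem Vb_unique {V : Set A} (h : UniqueDiffOn ℝ V) (ε : ℝ) : UniqueDiffOn ℝ (Vb V ε) :=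
  h.inter Metric.isOpen_ball

/-- The map is of class `C^k` into level `m` near `0`. -/
def Ck (S : ScScale E) (hS : Good S) (V : Set A) (m k : ℕ) (α : A → E) : Prop :=
  ∃ ε > (0:ℝ), ∃ g : A → Lev S hS m, (∀ x ∈ Vb V ε, (g x).v = α x) ∧ ContDiffOn ℝ k g (Vb V ε)

theorem Ck.of_le {S : ScScale E} {hS : Good S} {V : Set A} {m k l : ℕ} {α : A → E}
    (h : Ck S hS V m k α) (hl : l ≤ k) : Ck S hS V m l α := by
  obtain ⟨ε, hε, g, hg, hc⟩ := h
  exact ⟨ε, hε, g, hg, hc.of_le (by exact_mod_cast hl)⟩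

/-- The implicit function problem. -/
structure Prob (S : ScScale E) (hS : Good S) (T : ScScale F) (R : ScScale H) (V : Set A) (k : ℕ)
    (U : Set E) (Φ : E → F) (α : A → E) (l : H →ₗ[ℝ] E) (pr : F →ₗ[ℝ] H) (δ : A → H) : Prop where
  h0 : (0:A) ∈ V
  sck : IsSck k S T U Φ
  ha : ∀ m, Ck S hS V m k α
  hl : ∀ m, LB R m S m l
  hpr : ∀ m, LB T m R m pr
  hU : ∃ ε > (0:ℝ), ∀ x ∈ Vb V ε, ∀ y ∈ R.level 0, R.lnorm 0 (y - δ 0) < ε → α x + l y ∈ U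
  hc : ∀ m, ∃ Θ : ℝ, 0 ≤ Θ ∧ Θ < 1 ∧ ∃ ε > (0:ℝ), ∀ x ∈ Vb V ε,
    ∀ y ∈ R.level m, ∀ y' ∈ R.level m, R.lnorm m (y - δ 0) < ε → R.lnorm m (y' - δ 0) < ε →
      R.lnorm m (y - y' - (pr (Φ (α x + l y)) - pr (Φ (α x + l y')))) ≤ Θ * R.lnorm m (y - y')
  hd : ∀ m, ∀ ρ > (0:ℝ), ∃ ε > (0:ℝ), ∀ x ∈ Vb V ε, δ x ∈ R.level m ∧
    R.lnorm m (δ x - δ 0) < ρ ∧ pr (Φ (α x + l (δ x))) = 0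

theorem sck_sc0 {S : ScScale E} {T : ScScale F} {U : Set E} {Φ : E → F} {k : ℕ}
    (h : IsSck k S T U Φ) : Sc0 S T U Φ := by
  cases k with
  | zero => exact h
  | succ k => exact h.1

variable {S : ScScale E} {hS : Good S} {T : ScScale F} {hT : Good T} {R : ScScale H} {hR : Good R}
  {V : Set A} {k : ℕ} {U : Set E} {Φ : E → F} {DΦ : E → (E →ₗ[ℝ] F)}
  {α : A → E} {l : H →ₗ[ℝ] E} {pr : F →ₗ[ℝ] H} {δ : A → H}

theorem Prob.lev (hR : Good R) (P : Prob S hS T R V k U Φ α l pr δ) (m : ℕ) (ρ : ℝ) (hρ : 0 < ρ) :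
    ∃ ε > (0:ℝ), ∀ x ∈ Vb V ε, α x ∈ S.level m ∧ δ x ∈ R.level m ∧ R.lnorm m (δ x - δ 0) < ρ ∧
      pr (Φ (α x + l (δ x))) = 0 ∧ (∀ x' ∈ Vb V ε, α x' + l (δ x) ∈ U) ∧
      R.lnorm 0 (δ x - δ 0) < ρ ∧
      ∀ y ∈ R.level 0, R.lnorm 0 (y - δ x) < ε → α x + l y ∈ U := by
  obtain ⟨ε1, h1, g, hg, -⟩ := P.ha m
  obtain ⟨ε2, h2, hd⟩ := P.hd m ρ hρ
  obtain ⟨ε3, h3, hU⟩ := P.hU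
  obtain ⟨ε4, h4, hd0⟩ := P.hd 0 (min ρ (ε3 / 2)) (by positivity)
  refine ⟨min (min ε1 ε2) (min (ε3 / 2) ε4), by positivity, fun x hx => ?_⟩
  have x1 : x ∈ Vb V ε1 := Vb_mono ((min_le_left _ _).trans (min_le_left _ _)) hx
  have x2 : x ∈ Vb V ε2 := Vb_mono ((min_le_left _ _).trans (min_le_right _ _)) hx
  have hle3 : min (min ε1 ε2) (min (ε3 / 2) ε4) ≤ ε3 / 2 :=
    (min_le_right _ _).trans (min_le_left _ _)
  have x3 : x ∈ Vb V ε3 := Vb_mono (hle3.trans (by linarith)) hx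
  have x4 : x ∈ Vb V ε4 := Vb_mono ((min_le_right _ _).trans (min_le_right _ _)) hx
  have hz : (0:A) ∈ Vb V ε4 := ⟨P.h0, Metric.mem_ball_self h4⟩
  obtain ⟨a1, a2, a3⟩ := hd x x2
  obtain ⟨b1, b2, b3⟩ := hd0 x x4
  have b2' := (lt_min_iff.1 b2)
  refine ⟨hg x x1 ▸ (g x).mem, a1, a2, a3, fun x' hx' => ?_, b2'.1, fun y hy hlt => ?_⟩
  · have x3' : x' ∈ Vb V ε3 := Vb_mono (hle3.trans (by linarith)) hx'
    exact hU x' x3' _ b1 (by linarith [b2'.2])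
  · refine hU x x3 y hy ?_
    have d0 : δ 0 ∈ R.level 0 := (hd0 0 hz).1
    have := hR.tri 0 (y - δ x) (sub_mem hy b1) (δ x - δ 0) (sub_mem b1 d0)
    rw [sub_add_sub_cancel] at this
    linarith [b2'.2]

theorem Prob.est (hR : Good R) (P : Prob S hS T R V k U Φ α l pr δ) (m : ℕ) :
    ∃ c > (0:ℝ), ∃ ε > (0:ℝ), ∀ x ∈ Vb V ε, ∀ x' ∈ Vb V ε, δ x ∈ R.level m ∧
      pr (Φ (α x' + l (δ x))) ∈ R.level m ∧ α x ∈ S.level m ∧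
      pr (Φ (α x + l (δ x))) = 0 ∧ α x' + l (δ x) ∈ U ∧
      c * R.lnorm m (δ x' - δ x) ≤ R.lnorm m (pr (Φ (α x' + l (δ x)))) := by
  obtain ⟨Θ, hΘ0, hΘ1, ε1, h1, hc⟩ := P.hc m
  obtain ⟨ε2, h2, hd⟩ := P.lev hR m ε1 h1
  refine ⟨1 - Θ, by linarith, min ε1 ε2, by positivity, fun x hx x' hx' => ?_⟩
  have x2 := Vb_mono (min_le_right _ _) hx
  have x1' := Vb_mono (min_le_left _ _) hx'
  have x2' := Vb_mono (min_le_right _ _) hx'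
  obtain ⟨a1, a2, a3, a4, a5, -⟩ := hd x x2
  obtain ⟨b1, b2, b3, b4, b5, -⟩ := hd x' x2'
  have hF : pr (Φ (α x' + l (δ x))) ∈ R.level m :=
    (P.hpr m).1 _ ((sck_sc0 P.sck m).1 _ ⟨a5 x' x2', add_mem b1 ((P.hl m).1 _ a2)⟩)
  refine ⟨a2, hF, a1, a4, a5 x' x2', ?_⟩
  have h := hc x' x1' (δ x') b2 (δ x) a2 b3 a3
  rw [b4, zero_sub, sub_neg_eq_add] at h
  let p : Lev R hR m := mkL hR (δ x') b2
  let q : Lev R hR m := mkL hR (δ x) a2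
  let r : Lev R hR m := mkL hR _ hF
  have h' : ‖p - q + r‖ ≤ Θ * ‖p - q‖ := h
  have h3 : ‖p - q‖ ≤ ‖p - q + r‖ + ‖r‖ := by
    have := norm_sub_le (p - q + r) r
    simpa using this
  change (1 - Θ) * ‖p - q‖ ≤ ‖r‖
  linarith

theorem Prob.cont (hT : Good T) (P : Prob S hS T R V k U Φ α l pr δ) (m : ℕ) :
    Ck R hR V m 0 δ := by
  obtain ⟨c, hc, ε1, h1, hest⟩ := P.est hR m
  obtain ⟨ε2, h2, g, hg, hgc⟩ := P.ha m
  refine ⟨min ε1 ε2, by positivity, fun x => toLev hR m (δ x), fun x hx => ?_, ?_⟩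
  · have x1 := Vb_mono (min_le_left _ _) hx
    exact toLev_v (hest x x1 x x1).1
  rw [show ((0:ℕ) : WithTop ℕ∞) = 0 from rfl, contDiffOn_zero]
  intro x hx
  have x1 := Vb_mono (min_le_left _ _) hx
  have dx := (hest x x1 x x1).1
  have c1 : ContinuousOn (fun x' => toLev hR m (pr (Φ (α x' + l (δ x))))) (Vb V (min ε1 ε2)) := by
    have c0 := (levMap hT hR (P.hpr m)).continuous.comp_continuousOn
      ((sc0_cont hS hT (sck_sc0 P.sck) m).comp
        (f := fun x' => g x' + levMap hR hS (P.hl m) (mkL hR (δ x) dx)) (s := Vb V (min ε1 ε2))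
        ((hgc.continuousOn.mono (Vb_mono (min_le_right _ _))).add continuousOn_const) (by
          intro x' hx'
          have x1' := Vb_mono (min_le_left _ _) hx'
          have x2' := Vb_mono (min_le_right _ _) hx'
          have := (hest x x1 x' x1').2.2.2.2.1
          simpa [hg x' x2'] using this))
    refine c0.congr fun x' hx' => Lev.ext ?_
    have x1' := Vb_mono (min_le_left _ _) hx'
    have x2' := Vb_mono (min_le_right _ _) hx'
    have hh := hest x x1 x' x1'
    have hh' := hest x' x1' x x1
    rw [toLev_v hh.2.1]
    simp only [Function.comp, levMap_v, Lev.v_add, mkL_v, hg x' x2']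
    rw [toLev_v ((sck_sc0 P.sck m).1 _ ⟨hh.2.2.2.2.1, add_mem hh'.2.2.1 ((P.hl m).1 _ dx)⟩)]
  have c2 := (c1 x hx).tendsto
  rw [(hest x x1 x x1).2.2.2.1] at c2
  have e0 : toLev hR m (0 : H) = 0 := Lev.ext (by rw [toLev_v (zero_mem _)]; rfl)
  rw [e0] at c2
  have c3 := (c2.norm).const_mul c⁻¹
  rw [norm_zero, mul_zero] at c3
  refine tendsto_iff_norm_sub_tendsto_zero.2 (squeeze_zero' (Eventually.of_forall fun _ =>
    norm_nonneg _) ?_ c3)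
  filter_upwards [self_mem_nhdsWithin] with x' hx'
  have x1' := Vb_mono (min_le_left _ _) hx'
  have hh := hest x x1 x' x1'
  have hh' := hest x' x1' x x1
  rw [Lev.norm_def, Lev.norm_def, Lev.v_sub, toLev_v hh.2.1, toLev_v dx, toLev_v hh'.1]
  rw [le_inv_mul_iff₀ hc]
  exact hh.2.2.2.2.2

end main
end GIFT


namespace GIFT
set_option linter.unusedSectionVars false
open Set Filter Topology

section main2
variable {A : Type z} [NormedAddCommGroup A] [NormedSpace ℝ A]
variable {E : Type u} {F : Type v} [AddCommGroup E] [Module ℝ E] [AddCommGroup F] [Module ℝ F]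
variable {H : Type w} [AddCommGroup H] [Module ℝ H]
variable {S : ScScale E} {hS : Good S} {T : ScScale F} {hT : Good T} {R : ScScale H} {hR : Good R}
  {V : Set A} {k : ℕ} {U : Set E} {Φ : E → F} {DΦ : E → (E →ₗ[ℝ] F)}
  {α : A → E} {l : H →ₗ[ℝ] E} {pr : F →ₗ[ℝ] H} {δ : A → H}

/-- `α'` is the derivative of `α` on all levels near `0`, of class `C^k`. -/
def DerOf (S : ScScale E) (hS : Good S) (V : Set A) (k : ℕ) (α : A → E) (α' : A → A → E) : Prop :=
  ∀ m, ∃ ε > (0:ℝ), ∃ g : A → Lev S hS m, ∃ g' : A → A →L[ℝ] Lev S hS m,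
    (∀ x ∈ Vb V ε, (g x).v = α x) ∧ (∀ x ∈ Vb V ε, ∀ b, (g' x b).v = α' x b) ∧
    (∀ x ∈ Vb V ε, HasFDerivWithinAt g (g' x) (Vb V ε) x) ∧ ContDiffOn ℝ k g' (Vb V ε)

theorem ck_der (hV : UniqueDiffOn ℝ V) (ha : ∀ m, Ck S hS V m (k+1) α) :
    ∃ α' : A → A → E, DerOf S hS V k α α' := by
  choose ε hε g hg hgc using ha
  refine ⟨fun x b => (fderivWithin ℝ (g 0) (Vb V (ε 0)) x b).v, fun m => ?_⟩
  have sm : Vb V (min (ε m) (ε 0)) ⊆ Vb V (ε m) := Vb_mono (min_le_left _ _)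
  have s0 : Vb V (min (ε m) (ε 0)) ⊆ Vb V (ε 0) := Vb_mono (min_le_right _ _)
  have hu := Vb_unique hV (min (ε m) (ε 0))
  have hcm := (hgc m).mono sm
  have hcm' : ContDiffOn ℝ ((k : WithTop ℕ∞) + 1) (g m) (Vb V (min (ε m) (ε 0))) := by
    exact_mod_cast hcm
  have hdm := hcm'.differentiableOn (by simp)
  refine ⟨min (ε m) (ε 0), lt_min (hε m) (hε 0), g m,
    fderivWithin ℝ (g m) (Vb V (min (ε m) (ε 0))), fun x hx => hg m x (sm hx), ?_,
    fun x hx => (hdm x hx).hasFDerivWithinAt,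
    ((contDiffOn_succ_iff_fderivWithin hu).1 hcm').2.2⟩
  intro x hx b
  have d1 := (incl hS (Nat.zero_le m)).hasFDerivAt.comp_hasFDerivWithinAt x
    (hdm x hx).hasFDerivWithinAt
  have h00 : ContDiffOn ℝ ((k : WithTop ℕ∞) + 1) (g 0) (Vb V (ε 0)) := by
    exact_mod_cast hgc 0
  have d2 := ((h00.differentiableOn (by simp)) x (s0 hx)).hasFDerivWithinAt.mono s0
  have e : ∀ y ∈ Vb V (min (ε m) (ε 0)), g 0 y = incl hS (Nat.zero_le m) (g m y) := fun y hy =>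
    Lev.ext (by rw [incl_v, hg m y (sm hy), hg 0 y (s0 hy)])
  have d3 := d1.congr e (e x hx)
  have := (hu x hx).eq d3 d2
  have h4 := congrArg (fun L => (L b).v) this
  simpa using h4

/-- The linearized contraction property. -/
theorem Prob.lin (hT : Good T) (hR : Good R) (hcR : ∀ m, CompleteSpace (Lev R hR m))
    (hden : ∀ m, ∀ x ∈ R.level m, ∀ ε > (0:ℝ), ∃ y, (∀ n, y ∈ R.level n) ∧ R.lnorm m (x - y) < ε)
    (P : Prob S hS T R V k U Φ α l pr δ) (h1 : Sc1With S T U Φ DΦ) (m : ℕ) :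
    ∃ Θ : ℝ, 0 ≤ Θ ∧ Θ < 1 ∧ ∃ ε > (0:ℝ), ∀ x ∈ Vb V ε,
      α x ∈ S.level (m+1) ∧ δ x ∈ R.level (m+1) ∧ α x + l (δ x) ∈ U ∧
      ∀ y ∈ R.level m, R.lnorm m (y - pr (DΦ (α x + l (δ x)) (l y))) ≤ Θ * R.lnorm m y := by
  obtain ⟨Θ, hΘ0, hΘ1, ε1, e1, hc⟩ := P.hc m
  obtain ⟨ε2, e2, hd⟩ := P.lev hR (m+1) 1 one_pos
  obtain ⟨ε3, e3, hd3⟩ := P.lev hR m (ε1/2) (by positivity)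
  refine ⟨Θ, hΘ0, hΘ1, min ε1 (min ε2 ε3), by positivity, fun x hx => ?_⟩
  have x1 := Vb_mono (min_le_left _ _) hx
  have x2 := Vb_mono ((min_le_right _ _).trans (min_le_left _ _)) hx
  have x3 := Vb_mono ((min_le_right _ _).trans (min_le_right _ _)) hx
  obtain ⟨a1, a2, a3, a4, a5, a6, a7⟩ := hd x x2
  obtain ⟨b1, b2, b3, b4, -, -, -⟩ := hd3 x x3
  have d0 : δ 0 ∈ R.level m := (hd3 0 (Vb_zero P.h0 e3)).2.1
  have hxU := a5 x x2
  have hyl : α x + l (δ x) ∈ S.level (m+1) := add_mem a1 ((P.hl _).1 _ a2)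
  refine ⟨a1, a2, hxU, ?_⟩
  -- the operator on level m
  let M : Lev R hR m →L[ℝ] Lev R hR m := (levMap hT hR (P.hpr m)).comp
    ((levMap hS hT (sc1_lb hS hT h1 hxU hyl)).comp (levMap hR hS (P.hl m)))
  have hM : ∀ y : Lev R hR m, (M y).v = pr (DΦ (α x + l (δ x)) (l y.v)) := fun y => rfl
  suffices hs : ∀ y : Lev R hR m, ‖y - M y‖ ≤ Θ * ‖y‖ from fun y hy => hs (mkL hR y hy)
  have hsm : ∀ y ∈ R.level (m+1), ∀ hy : y ∈ R.level m,
      ‖mkL hR y hy - M (mkL hR y hy)‖ ≤ Θ * ‖mkL hR y hy‖ := by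
    intro y hy1 hy
    have hy0 : y ∈ R.level 0 := hR.nest (Nat.zero_le _) hy
    obtain ⟨r, hr, hr1, hr2⟩ : ∃ r > (0:ℝ), (∀ t : ℝ, |t| < r → |t| * R.lnorm 0 y < ε2) ∧
        (∀ t : ℝ, |t| < r → |t| * R.lnorm m y < ε1 / 2) := by
      have n0 := hR.nonneg 0 y
      have n1 := hR.nonneg m y
      refine ⟨min (ε2 / (R.lnorm 0 y + 1)) (ε1 / 2 / (R.lnorm m y + 1)), by positivity, ?_, ?_⟩
      · intro t ht
        have := ht.trans_le (min_le_left _ _)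
        rw [lt_div_iff₀ (by positivity)] at this
        nlinarith [abs_nonneg t]
      · intro t ht
        have := ht.trans_le (min_le_right _ _)
        rw [lt_div_iff₀ (by positivity)] at this
        nlinarith [abs_nonneg t]
    let ly : Lev S hS (m+1) := levMap hR hS (P.hl (m+1)) (mkL hR y hy1)
    let g : ℝ → Lev S hS (m+1) := fun t => mkL hS _ hyl + t • ly
    have hgv : ∀ t, (g t).v = α x + l (δ x + t • y) := fun t => by simp [g, ly, add_assoc]
    let g' : ℝ → ℝ →L[ℝ] Lev S hS (m+1) := fun _ => ContinuousLinearMap.toSpanSingleton ℝ ly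
    have hg : ∀ t, HasFDerivAt g (g' t) t := by
      intro t
      have := ((hasDerivAt_id t).smul_const ly).const_add (mkL hS _ hyl)
      have h2 := this.hasFDerivAt
      simpa [g, g'] using h2
    have hUt : ∀ t ∈ Metric.ball (0:ℝ) r, (g t).v ∈ U := by
      intro t ht
      rw [hgv]
      have ht' : |t| < r := by simpa using ht
      refine a7 _ (add_mem (hR.nest (Nat.zero_le _) a2) (Submodule.smul_mem _ _ hy0)) ?_
      rw [add_sub_cancel_left, hR.smul 0 t y hy0]
      exact hr1 t ht'
    obtain ⟨G', hG', -, hGd⟩ := chain (m := m) hS hT hR hcR P.hpr (sck_sc0 P.sck) h1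
      (convex_ball (0:ℝ) r) (fun t _ => (hg t).hasFDerivWithinAt) (continuousOn_const) hUt
    have hz : (0:ℝ) ∈ Metric.ball (0:ℝ) r := Metric.mem_ball_self hr
    have d1 := (hGd 0 hz).hasFDerivAt (Metric.ball_mem_nhds _ hr)
    let yl : Lev R hR m := mkL hR y hy
    have d2 : HasFDerivAt (fun t : ℝ => t • yl - toLev hR m (pr (Φ (g t).v)))
      (ContinuousLinearMap.toSpanSingleton ℝ yl - G' 0) 0 := by
      refine HasFDerivAt.sub ?_ d1
      have := ((hasDerivAt_id (0:ℝ)).smul_const yl).hasFDerivAt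
      simpa using this
    have hFm : ∀ t ∈ Metric.ball (0:ℝ) r, pr (Φ (g t).v) ∈ R.level m := fun t ht =>
      (P.hpr m).1 _ ((sck_sc0 P.sck m).1 _ ⟨hUt t ht, hS.nest (Nat.le_succ m) (g t).mem⟩)
    have h3 := d2.le_of_lip' (C := Θ * ‖yl‖) (by positivity) (by
      filter_upwards [Metric.ball_mem_nhds (0:ℝ) hr] with t ht
      have ht' : |t| < r := by simpa using ht
      have hml : δ x + t • y ∈ R.level m := add_mem b2 (Submodule.smul_mem _ _ hy)
      have := hc x x1 (δ x + t • y) hml (δ x) b2 (by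
        have h5 := hR.tri m (δ x - δ 0) (sub_mem b2 d0) (t • y) (Submodule.smul_mem _ _ hy)
        rw [hR.smul m t y hy] at h5
        have h6 := hr2 t ht'
        rw [show δ x + t • y - δ 0 = δ x - δ 0 + t • y by abel]
        linarith) (by linarith)
      rw [add_sub_cancel_left, hR.smul m t y hy] at this
      rw [Lev.norm_def, Lev.norm_def]
      simp only [Lev.v_sub, Lev.v_smul]
      rw [toLev_v (hFm t ht), toLev_v (hFm 0 hz), hgv, hgv]
      simp only [zero_smul, add_zero, zero_sub, sub_zero, mkL_v, yl]
      rw [Real.norm_eq_abs]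
      calc _ = _ := by congr 1; abel
        _ ≤ _ := this
        _ = _ := by ring)
    have h4 := (ContinuousLinearMap.toSpanSingleton ℝ yl - G' 0).le_opNorm 1
    have h5 : (ContinuousLinearMap.toSpanSingleton ℝ yl - G' 0) 1 = yl - M yl := by
      apply Lev.ext
      rw [sub_apply, Lev.v_sub, Lev.v_sub, hG' 0 hz, hM, hgv]
      simp [g', ly, yl]
    rw [h5] at h4
    calc _ ≤ _ := h4
      _ ≤ _ := by simpa using h3
  intro y
  refine le_of_forall_pos_le_add fun ε hε => ?_
  -- density
  have hcl : IsClosed {y : Lev R hR m | ‖y - M y‖ ≤ Θ * ‖y‖} :=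
    isClosed_le (by fun_prop) (by fun_prop)
  have : y ∈ closure {y : Lev R hR m | ‖y - M y‖ ≤ Θ * ‖y‖} := by
    rw [Metric.mem_closure_iff]
    intro e he
    obtain ⟨z, hz, hlt⟩ := hden m y.v y.mem e he
    refine ⟨mkL hR z (hz m), hsm z (hz _) (hz m), ?_⟩
    rw [dist_eq_norm]
    exact hlt
  rw [hcl.closure_eq] at this
  have h6 : ‖y - M y‖ ≤ Θ * ‖y‖ := this
  linarith

end main2
end GIFT


namespace GIFT
set_option linter.unusedSectionVars false
open Set Filter Topology Asymptotics

section main3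
variable {A : Type z} [NormedAddCommGroup A] [NormedSpace ℝ A]
variable {E : Type u} {F : Type v} [AddCommGroup E] [Module ℝ E] [AddCommGroup F] [Module ℝ F]
variable {H : Type w} [AddCommGroup H] [Module ℝ H]
variable {S : ScScale E} {hS : Good S} {T : ScScale F} {hT : Good T} {R : ScScale H} {hR : Good R}
  {V : Set A} {k : ℕ} {U : Set E} {Φ : E → F} {DΦ : E → (E →ₗ[ℝ] F)}
  {α : A → E} {l : H →ₗ[ℝ] E} {pr : F →ₗ[ℝ] H} {δ : A → H} {α' : A → A → E}

theorem Prob.solve (hT : Good T) (hR : Good R) (hcR : ∀ m, CompleteSpace (Lev R hR m))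
    (hden : ∀ m, ∀ x ∈ R.level m, ∀ ε > (0:ℝ), ∃ y, (∀ n, y ∈ R.level n) ∧ R.lnorm m (x - y) < ε)
    (P : Prob S hS T R V k U Φ α l pr δ) (h1 : Sc1With S T U Φ DΦ) {j : ℕ}
    (hα' : DerOf S hS V j α α') (m : ℕ) :
    ∃ ε > (0:ℝ), ∀ x ∈ Vb V ε,
      (∃ Y : A →L[ℝ] Lev R hR m, ∀ b, pr (DΦ (α x + l (δ x)) (α' x b + l (Y b).v)) = 0) ∧
      (∀ y ∈ R.level m, pr (DΦ (α x + l (δ x)) (l y)) = 0 → y = 0) := by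
  obtain ⟨Θ, hΘ0, hΘ1, ε1, e1, hlin⟩ := P.lin hT hR hcR hden h1 m
  obtain ⟨ε2, e2, g, g', hg, hg', -, -⟩ := hα' m
  refine ⟨min ε1 ε2, by positivity, fun x hx => ?_⟩
  have x1 := Vb_mono (min_le_left _ _) hx
  have x2 := Vb_mono (min_le_right _ _) hx
  obtain ⟨a1, a2, hxU, a4⟩ := hlin x x1
  have hyl : α x + l (δ x) ∈ S.level (m+1) := add_mem a1 ((P.hl _).1 _ a2)
  let K : Lev S hS m →L[ℝ] Lev R hR m := (levMap hT hR (P.hpr m)).comp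
    (levMap hS hT (sc1_lb hS hT h1 hxU hyl))
  let M : Lev R hR m →L[ℝ] Lev R hR m := K.comp (levMap hR hS (P.hl m))
  have hM : ∀ y : Lev R hR m, ‖(1 - M) y‖ ≤ Θ * ‖y‖ := fun y => a4 y.v y.mem
  have hM1 : ‖(1 : Lev R hR m →L[ℝ] Lev R hR m) - M‖ < 1 :=
    (ContinuousLinearMap.opNorm_le_bound _ hΘ0 hM).trans_lt hΘ1
  constructor
  · have hu : IsUnit M := by
      have := isUnit_one_sub_of_norm_lt_one hM1
      rwa [sub_sub_cancel] at this
    obtain ⟨N, hMN⟩ := hu.exists_right_inv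
    refine ⟨-(N.comp (K.comp (g' x))), fun b => ?_⟩
    have h2 : M (N (K (g' x b))) = K (g' x b) :=
      congrArg (fun L : Lev R hR m →L[ℝ] Lev R hR m => L (K (g' x b))) hMN
    have h3 := congrArg Lev.v h2
    have h4 : pr (DΦ (α x + l (δ x)) (l (N (K (g' x b))).v)) = pr (DΦ (α x + l (δ x)) (α' x b)) := by
      rw [← hg' x x2 b]; exact h3
    have h5 : ((-(N.comp (K.comp (g' x)))) b).v = -(N (K (g' x b))).v := rfl
    rw [h5, map_neg, map_add, map_neg, map_add, map_neg, h4, add_neg_cancel]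
  · intro y hy h0
    have := a4 y hy
    rw [h0, sub_zero] at this
    refine hR.defi m y hy ?_
    nlinarith [hR.nonneg m y]

theorem Prob.der0 (hT : Good T) (hR : Good R) (hcR : ∀ m, CompleteSpace (Lev R hR m))
    [FiniteDimensional ℝ A] (hV : Convex ℝ V)
    (hden : ∀ m, ∀ x ∈ R.level m, ∀ ε > (0:ℝ), ∃ y, (∀ n, y ∈ R.level n) ∧ R.lnorm m (x - y) < ε)
    (P : Prob S hS T R V k U Φ α l pr δ) (h1 : Sc1With S T U Φ DΦ) {j : ℕ}
    (hα' : DerOf S hS V j α α') :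
    ∃ ε > (0:ℝ), ∀ x ∈ Vb V ε, ∀ Y : A →L[ℝ] Lev R hR 0,
      (∀ b, pr (DΦ (α x + l (δ x)) (α' x b + l (Y b).v)) = 0) →
      HasFDerivWithinAt (fun x => toLev hR 0 (δ x)) Y (Vb V ε) x := by
  obtain ⟨Θ, hΘ0, hΘ1, ε1, e1, hlin⟩ := P.lin hT hR hcR hden h1 1
  obtain ⟨Θ', hΘ0', hΘ1', ε1', e1', hlin'⟩ := P.lin hT hR hcR hden h1 0
  obtain ⟨ε2, e2, g, g', hg, hg', hgd, hgc⟩ := hα' 2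
  obtain ⟨c, hc, ε3, e3, hest⟩ := P.est hR 1
  obtain ⟨ε, e0, le1, le1', le2, le3⟩ : ∃ ε > (0:ℝ), ε ≤ ε1 ∧ ε ≤ ε1' ∧ ε ≤ ε2 ∧ ε ≤ ε3 :=
    ⟨min (min ε1 ε1') (min ε2 ε3), by positivity,
      (min_le_left _ _).trans (min_le_left _ _), (min_le_left _ _).trans (min_le_right _ _),
      (min_le_right _ _).trans (min_le_left _ _), (min_le_right _ _).trans (min_le_right _ _)⟩
  refine ⟨ε, e0, fun x hx Y hY => ?_⟩
  set W := Vb V ε with hW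
  have s1 : W ⊆ Vb V ε1 := Vb_mono le1
  have s1' : W ⊆ Vb V ε1' := Vb_mono le1'
  have s2 : W ⊆ Vb V ε2 := Vb_mono le2
  have s3 : W ⊆ Vb V ε3 := Vb_mono le3
  have hgd' : ∀ y ∈ W, HasFDerivWithinAt g (g' y) W y := fun y hy => (hgd y (s2 hy)).mono s2
  -- Lipschitz estimate on level 1
  let q : A → Lev R hR 1 := fun y => toLev hR 1 (δ y)
  have hq : ∀ y ∈ W, (q y).v = δ y := fun y hy => toLev_v (hest y (s3 hy) y (s3 hy)).1
  have hδ2 : δ x ∈ R.level 2 := (hlin x (s1 hx)).2.1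
  have lip : (fun y => q y - q x) =O[𝓝[W] x] fun y => y - x := by
    obtain ⟨G', -, -, hGd⟩ := chain (m := 1) hS hT hR hcR P.hpr (sck_sc0 P.sck) h1
      (Vb_convex hV ε) (g := fun y => g y + levMap hR hS (P.hl 2) (mkL hR (δ x) hδ2)) (g' := g')
      (fun y hy => (hgd' y hy).add_const _) (hgc.continuousOn.mono s2)
      (fun y hy => by simpa [hg y (s2 hy)] using (hest x (s3 hx) y (s3 hy)).2.2.2.2.1)
    have b1 := (hGd x hx).isBigO_sub
    refine IsBigO.trans (IsBigO.of_bound c⁻¹ ?_) b1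
    filter_upwards [self_mem_nhdsWithin] with y hy
    have hh := hest x (s3 hx) y (s3 hy)
    rw [Lev.norm_def, Lev.norm_def, Lev.v_sub, Lev.v_sub, hq y hy, hq x hx]
    simp only [Lev.v_add, levMap_v, mkL_v, hg y (s2 hy), hg x (s2 hx)]
    rw [toLev_v hh.2.1, hh.2.2.2.1, toLev_v (zero_mem _), sub_zero, le_inv_mul_iff₀ hc]
    exact hh.2.2.2.2.2
  -- the path on level 1
  let p : A → Lev S hS 1 := fun y => incl hS (Nat.le_succ 1) (g y) + levMap hR hS (P.hl 1) (q y)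
  have hp : ∀ y ∈ W, (p y).v = α y + l (δ y) := fun y hy => by
    simp [p, hg y (s2 hy), hq y hy]
  have hpU : ∀ y ∈ W, (p y).v ∈ U := fun y hy => by
    rw [hp y hy]; exact (hest y (s3 hy) y (s3 hy)).2.2.2.2.1
  have pO : (fun y => p y - p x) =O[𝓝[W] x] fun y => y - x := by
    have o1 := ((incl hS (Nat.le_succ 1)).isBigO_comp (fun y => g y - g x) (𝓝[W] x)).trans
      (hgd' x hx).isBigO_sub
    have o2 := ((levMap hR hS (P.hl 1)).isBigO_comp (fun y => q y - q x) (𝓝[W] x)).trans lip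
    refine (o1.add o2).congr_left fun y => ?_
    simp only [p, map_sub]; abel
  have pT : Tendsto p (𝓝[W] x) (𝓝[{y | y.v ∈ U}] (p x)) := by
    refine tendsto_nhdsWithin_iff.2 ⟨?_, ?_⟩
    · rw [tendsto_iff_norm_sub_tendsto_zero]
      have : Tendsto (fun y => y - x) (𝓝[W] x) (𝓝 0) := by
        have h : Tendsto (fun y : A => y - x) (𝓝 x) (𝓝 (x - x)) :=
          (continuous_id.sub continuous_const).tendsto x
        rw [sub_self] at h
        exact h.mono_left nhdsWithin_le_nhds
      exact tendsto_zero_iff_norm_tendsto_zero.1 (pO.trans_tendsto this)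
    · filter_upwards [self_mem_nhdsWithin] with y hy using hpU y hy
  let K : Lev S hS 0 →L[ℝ] Lev R hR 0 := (levMap hT hR (P.hpr 0)).comp
    (levMap hS hT (sc1_lb (m := 0) hS hT h1 (hpU x hx) (p x).mem))
  have hK : ∀ y, (K y).v = pr (DΦ (α x + l (δ x)) y.v) := fun y => by
    rw [← hp x hx]; rfl
  have o3 := ((sc1_deriv hS hT (sck_sc0 P.sck) h1 (p x) (hpU x hx)).isLittleO.comp_tendsto
    pT).trans_isBigO pO
  have o4 := ((levMap hT hR (P.hpr 0)).isBigO_comp _ _).trans_isLittleO o3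
  have o5 : (fun y => K (incl hS (Nat.zero_le 1) (p y - p x))) =o[𝓝[W] x] fun y => y - x := by
    refine o4.neg_left.congr' ?_ EventuallyEq.rfl
    filter_upwards [self_mem_nhdsWithin] with y hy
    apply Lev.ext
    have m1 : ∀ z ∈ W, Φ (p z).v ∈ T.level 0 := fun z hz =>
      (sck_sc0 P.sck 0).1 _ ⟨hpU z hz, hS.nest (Nat.zero_le 1) (p z).mem⟩
    have z1 : ∀ z ∈ W, pr (Φ (p z).v) = 0 := fun z hz => by
      rw [hp z hz]; exact (hest z (s3 hz) z (s3 hz)).2.2.2.1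
    rw [hK]
    simp only [Function.comp, Lev.v_neg, levMap_v, Lev.v_sub, ContinuousLinearMap.comp_apply,
      toLev_v (m1 y hy), toLev_v (m1 x hx), map_sub, z1 y hy, z1 x hx, incl_v]
    rw [hp x hx]; abel
  have o6 : (fun y => K (incl hS (Nat.zero_le 2) (g y - g x - g' x (y - x)))) =o[𝓝[W] x]
      fun y => y - x :=
    ((K.comp (incl hS (Nat.zero_le 2))).isBigO_comp _ _).trans_isLittleO (hgd' x hx).isLittleO
  have o7 := o5.sub o6
  rw [hasFDerivWithinAt_iff_isLittleO]
  refine IsBigO.trans_isLittleO (IsBigO.of_bound (1 - Θ')⁻¹ ?_) o7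
  filter_upwards [self_mem_nhdsWithin] with y hy
  set d : Lev R hR 0 := toLev hR 0 (δ y) - toLev hR 0 (δ x) - Y (y - x) with hd
  have m0 : ∀ z ∈ W, δ z ∈ R.level 0 := fun z hz => hq z hz ▸ hR.nest (Nat.zero_le 1) (q z).mem
  have hdv : d.v = δ y - δ x - (Y (y - x)).v := by
    rw [hd, Lev.v_sub, Lev.v_sub, toLev_v (m0 y hy), toLev_v (m0 x hx)]
  have e1 : (K (incl hS (Nat.zero_le 1) (p y - p x))
      - K (incl hS (Nat.zero_le 2) (g y - g x - g' x (y - x)))).v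
      = pr (DΦ (α x + l (δ x)) (l d.v)) := by
    have h3 := hY (y - x)
    rw [← hg' x (s2 hx)] at h3
    rw [Lev.v_sub, hK, hK, hdv, ← sub_zero (pr _ - pr _), ← h3]
    simp only [incl_v, Lev.v_sub, hp y hy, hp x hx, hg y (s2 hy), hg x (s2 hx), ← map_sub]
    congr 2
    simp only [map_sub]
    abel
  have e2 := (hlin' x (s1' hx)).2.2.2 d.v d.mem
  rw [← e1] at e2
  set w := (K (incl hS (Nat.zero_le 1) (p y - p x))
      - K (incl hS (Nat.zero_le 2) (g y - g x - g' x (y - x)))) with hw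
  have e3 : ‖d - w‖ ≤ Θ' * ‖d‖ := e2
  rw [le_inv_mul_iff₀ (by linarith)]
  have := norm_sub_le d (d - w)
  have h6 := norm_sub_norm_le d (d - w)
  rw [sub_sub_cancel] at h6
  linarith

end main3
end GIFT


namespace GIFT
set_option linter.unusedSectionVars false
open Set Filter Topology Asymptotics

theorem sck_mono (k : ℕ) : ∀ {E : Type u} {F : Type v} [AddCommGroup E] [Module ℝ E]
    [AddCommGroup F] [Module ℝ F] {S : ScScale E} {T : ScScale F} {U : Set E} {Φ : E → F},
    IsSck (k+1) S T U Φ → IsSck k S T U Φ := by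
  induction k with
  | zero => intro E F _ _ _ _ S T U Φ h; exact h.1
  | succ k ih =>
    intro E F _ _ _ _ S T U Φ h
    obtain ⟨h0, D, h1, h2⟩ := h
    exact ⟨h0, D, h1, ih h2⟩

theorem exists_common {ι : Type*} [Finite ι] (e : ι → ℝ) (he : ∀ i, 0 < e i) :
    ∃ ε > (0:ℝ), ∀ i, ε ≤ e i := by
  cases isEmpty_or_nonempty ι with
  | inl h => exact ⟨1, one_pos, fun i => h.elim i⟩
  | inr h =>
    obtain ⟨i, hi⟩ := Finite.exists_min e
    exact ⟨e i, he i, hi⟩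

section main4
variable {A : Type z} [NormedAddCommGroup A] [NormedSpace ℝ A]
variable {E : Type u} {F : Type v} [AddCommGroup E] [Module ℝ E] [AddCommGroup F] [Module ℝ F]
variable {H : Type w} [AddCommGroup H] [Module ℝ H]
variable {S : ScScale E} {hS : Good S} {T : ScScale F} {hT : Good T} {R : ScScale H} {hR : Good R}
  {V : Set A} {k : ℕ} {U : Set E} {Φ : E → F} {DΦ : E → (E →ₗ[ℝ] F)}
  {α : A → E} {l : H →ₗ[ℝ] E} {pr : F →ₗ[ℝ] H} {δ : A → H} {α' : A → A → E}

theorem Prob.mono (P : Prob S hS T R V (k+1) U Φ α l pr δ) : Prob S hS T R V k U Φ α l pr δ where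
  h0 := P.h0
  sck := sck_mono k P.sck
  ha m := (P.ha m).of_le (Nat.le_succ k)
  hl := P.hl
  hpr := P.hpr
  hU := P.hU
  hc := P.hc
  hd := P.hd

/-- The data of the linearized problem. -/
theorem Prob.next (hT : Good T) (hR : Good R) (hcR : ∀ m, CompleteSpace (Lev R hR m))
    (hden : ∀ m, ∀ x ∈ R.level m, ∀ ε > (0:ℝ), ∃ y, (∀ n, y ∈ R.level n) ∧ R.lnorm m (x - y) < ε)
    (P : Prob S hS T R V (k+1) U Φ α l pr δ) (h1 : Sc1With S T U Φ DΦ)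
    (hk : IsSck k S.tangent T.tangent (S.tangentSet U) (Tmap Φ DΦ))
    (hα' : DerOf S hS V k α α') (hδ : ∀ m, Ck R hR V m k δ) (b : A) (ξ : A → H)
    (hξ : ∃ ε > (0:ℝ), ∀ x ∈ Vb V ε, ξ x ∈ R.level 0 ∧
      pr (DΦ (α x + l (δ x)) (α' x b + l (ξ x))) = 0) :
    Prob S.tangent hS.tangent T.tangent R V k (S.tangentSet U) (Tmap Φ DΦ)
      (fun x => (α x + l (δ x), α' x b)) ((LinearMap.inr ℝ E E) ∘ₗ l)
      (pr ∘ₗ (LinearMap.snd ℝ F F)) ξ := by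
  have hα1 : ∀ m, Ck S.tangent hS.tangent V m k (fun x => (α x + l (δ x), α' x b)) := by
    intro m
    obtain ⟨ε1, e1, g, hg, hgc⟩ := P.mono.ha (m+1)
    obtain ⟨ε2, e2, d, hd, hdc⟩ := hδ (m+1)
    obtain ⟨ε3, e3, -, g', -, hg', -, hgc'⟩ := hα' m
    refine ⟨min ε1 (min ε2 ε3), by positivity, fun x =>
      levMap hS hS.tangent (lb_inl hS m) (g x + levMap hR hS (P.hl (m+1)) (d x)) +
      levMap hS hS.tangent (lb_inr hS m) (g' x b), fun x hx => ?_, ?_⟩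
    · have x1 := Vb_mono (min_le_left _ _) hx
      have x2 := Vb_mono ((min_le_right _ _).trans (min_le_left _ _)) hx
      have x3 := Vb_mono ((min_le_right _ _).trans (min_le_right _ _)) hx
      simp [hg x x1, hd x x2, hg' x x3]
    · have c1 := hgc.mono (Vb_mono (min_le_left ε1 (min ε2 ε3)))
      have c2 := hdc.mono (Vb_mono ((min_le_right ε1 (min ε2 ε3)).trans (min_le_left _ _)))
      have c3 := hgc'.mono (Vb_mono ((min_le_right ε1 (min ε2 ε3)).trans (min_le_right _ _)))
      refine ContDiffOn.add ?_ ?_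
      · exact (ContinuousLinearMap.contDiff _).comp_contDiffOn
          (c1.add ((ContinuousLinearMap.contDiff _).comp_contDiffOn c2))
      · exact (ContinuousLinearMap.contDiff _).comp_contDiffOn (c3.clm_apply contDiffOn_const)
  have hl1 : ∀ m, LB R m S.tangent m ((LinearMap.inr ℝ E E) ∘ₗ l) := fun m =>
    LB.comp hR hS hS.tangent (lb_inr hS m) (P.hl m)
  have hpr1 : ∀ m, LB T.tangent m R m (pr ∘ₗ (LinearMap.snd ℝ F F)) := fun m =>
    LB.comp hT.tangent hT hR (P.hpr m) (lb_snd hT m)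
  have hval : ∀ x y, (pr ∘ₗ (LinearMap.snd ℝ F F)) (Tmap Φ DΦ ((α x + l (δ x), α' x b)
      + ((LinearMap.inr ℝ E E) ∘ₗ l) y)) = pr (DΦ (α x + l (δ x)) (α' x b + l y)) := by
    intro x y; simp [Tmap]
  have hUU : ∃ ε > (0:ℝ), ∀ x ∈ Vb V ε, ∀ y ∈ R.level 0,
      (α x + l (δ x), α' x b) + ((LinearMap.inr ℝ E E) ∘ₗ l) y ∈ S.tangentSet U := by
    obtain ⟨Θ, hΘ0, hΘ1, ε1, e1, hlin⟩ := P.lin hT hR hcR hden h1 0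
    obtain ⟨ε3, e3, -, g', -, hg', -, -⟩ := hα' 0
    refine ⟨min ε1 ε3, by positivity, fun x hx y hy => ?_⟩
    have x1 := Vb_mono (min_le_left _ _) hx
    have x3 := Vb_mono (min_le_right _ _) hx
    obtain ⟨a1, a2, a3, -⟩ := hlin x x1
    have : α' x b ∈ S.level 0 := hg' x x3 b ▸ (g' x b).mem
    refine ⟨?_, ?_, ?_⟩
    · simpa using a3
    · simpa using add_mem a1 ((P.hl _).1 _ a2)
    · simpa using add_mem this ((P.hl _).1 _ hy)
  refine ⟨P.h0, hk, hα1, hl1, hpr1, ?_, ?_, ?_⟩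
  · obtain ⟨ε, e, h⟩ := hUU
    exact ⟨ε, e, fun x hx y hy _ => h x hx y hy⟩
  · intro m
    obtain ⟨Θ, hΘ0, hΘ1, ε1, e1, hlin⟩ := P.lin hT hR hcR hden h1 m
    refine ⟨Θ, hΘ0, hΘ1, ε1, e1, fun x hx y hy y' hy' _ _ => ?_⟩
    have := (hlin x hx).2.2.2 (y - y') (sub_mem hy hy')
    rw [hval, hval]
    simp only [map_add, map_sub] at this ⊢
    rwa [add_sub_add_left_eq_sub]
  · intro m ρ hρ
    obtain ⟨Θ, hΘ0, hΘ1, ε1, e1, hlin⟩ := P.lin hT hR hcR hden h1 m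
    obtain ⟨ε2, e2, hsol⟩ := P.solve hT hR hcR hden h1 hα' m
    obtain ⟨ε3, e3, hsol0⟩ := P.solve hT hR hcR hden h1 hα' 0
    obtain ⟨ε4, e4, hξ⟩ := hξ
    obtain ⟨ε5, e5, hU5⟩ := hUU
    obtain ⟨ε6, e6, g, hg, hgc⟩ := hα1 m
    obtain ⟨ε, e0, le⟩ := exists_common ![ε1, ε2, ε3, ε4, ε5, ε6]
      (by intro i; fin_cases i <;> assumption)
    have s1 : Vb V ε ⊆ Vb V ε1 := Vb_mono (le 0)
    have s2 : Vb V ε ⊆ Vb V ε2 := Vb_mono (le 1)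
    have s3 : Vb V ε ⊆ Vb V ε3 := Vb_mono (le 2)
    have s4 : Vb V ε ⊆ Vb V ε4 := Vb_mono (le 3)
    have s5 : Vb V ε ⊆ Vb V ε5 := Vb_mono (le 4)
    have s6 : Vb V ε ⊆ Vb V ε6 := Vb_mono (le 5)
    have hmem : ∀ x ∈ Vb V ε, ξ x ∈ R.level m := by
      intro x hx
      obtain ⟨⟨Y, hY⟩, -⟩ := hsol x (s2 hx)
      have h3 := (hsol0 x (s3 hx)).2 (ξ x - (Y b).v)
        (sub_mem (hξ x (s4 hx)).1 (hR.nest (Nat.zero_le _) (Y b).mem)) (by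
          have e1 := (hξ x (s4 hx)).2
          have e2 := hY b
          rw [map_add, map_add] at e1 e2
          rw [map_sub, map_sub, map_sub, eq_neg_of_add_eq_zero_right e1,
            eq_neg_of_add_eq_zero_right e2, sub_self])
      rw [sub_eq_zero.1 h3]
      exact (Y b).mem
    have z0 := Vb_zero P.h0 e0
    have m0 := hmem 0 z0
    -- continuity of the value at the frozen solution
    have c0 := (levMap hT.tangent hR (hpr1 m)).continuous.comp_continuousOn
      ((sc0_cont hS.tangent hT.tangent (sck_sc0 hk) m).comp
        (f := fun x => g x + levMap hR hS.tangent (hl1 m) (mkL hR (ξ 0) m0)) (s := Vb V ε)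
        ((hgc.continuousOn.mono s6).add continuousOn_const) (by
          intro x hx
          have := hU5 x (s5 hx) (ξ 0) (hR.nest (Nat.zero_le _) m0)
          simpa [hg x (s6 hx)] using this))
    have hv : ∀ x ∈ Vb V ε, ((levMap hT.tangent hR (hpr1 m)) (toLev hT.tangent m (Tmap Φ DΦ
        (g x + levMap hR hS.tangent (hl1 m) (mkL hR (ξ 0) m0)).v))).v
        = pr (DΦ (α x + l (δ x)) (α' x b + l (ξ 0))) := by
      intro x hx
      have hmm : (g x + levMap hR hS.tangent (hl1 m) (mkL hR (ξ 0) m0)).v ∈ S.tangentSet U := by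
        have := hU5 x (s5 hx) (ξ 0) (hR.nest (Nat.zero_le _) m0)
        simpa [hg x (s6 hx)] using this
      rw [levMap_v, toLev_v ((sck_sc0 hk m).1 _ ⟨hmm, Lev.mem _⟩), ← hval, Lev.v_add, levMap_v,
        mkL_v, hg x (s6 hx)]
    have c2 := Metric.continuousWithinAt_iff.1 (c0 0 z0) ((1 - Θ) * ρ)
      (mul_pos (by linarith) hρ)
    obtain ⟨r, hr, hb⟩ := c2
    refine ⟨min ε r, by positivity, fun x hx => ?_⟩
    have x0 : x ∈ Vb V ε := Vb_mono (min_le_left _ _) hx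
    have xr : dist x 0 < r := (Vb_mono (min_le_right _ _) hx).2
    refine ⟨hmem x x0, ?_, ?_⟩
    · have h3 := hb x0 xr
      rw [dist_eq_norm, Lev.norm_def, Lev.v_sub] at h3
      simp only [Function.comp] at h3
      rw [hv x x0, hv 0 z0, (hξ 0 (s4 z0)).2, sub_zero] at h3
      have h4 := (hlin x (s1 x0)).2.2.2 (ξ x - ξ 0) (sub_mem (hmem x x0) m0)
      have h5 : pr (DΦ (α x + l (δ x)) (l (ξ x - ξ 0)))
          = - pr (DΦ (α x + l (δ x)) (α' x b + l (ξ 0))) := by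
        have e1 := (hξ x (s4 x0)).2
        have e2 : α' x b + l (ξ x) = l (ξ x - ξ 0) + (α' x b + l (ξ 0)) := by
          rw [map_sub]; abel
        rw [e2, map_add, map_add] at e1
        exact eq_neg_of_add_eq_zero_left e1
      rw [h5] at h4
      have hm2 : pr (DΦ (α x + l (δ x)) (α' x b + l (ξ 0))) ∈ R.level m := by
        rw [← hv x x0]; exact Lev.mem _
      let p : Lev R hR m := mkL hR _ (sub_mem (hmem x x0) m0)
      let q : Lev R hR m := mkL hR _ hm2
      have h6 : ‖p - -q‖ ≤ Θ * ‖p‖ := h4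
      have h7 : ‖q‖ < (1 - Θ) * ρ := h3
      change ‖p‖ < ρ
      have h8 : ‖p‖ ≤ ‖p - -q‖ + ‖q‖ := by
        have := norm_sub_le (p - -q) q
        simpa using this
      have h9 : (1 - Θ) * ‖p‖ < (1 - Θ) * ρ := by linarith
      exact lt_of_mul_lt_mul_left h9 (by linarith)
    · rw [hval]
      exact (hξ x (s4 x0)).2

end main4

theorem main_ck {A : Type z} [NormedAddCommGroup A] [NormedSpace ℝ A] [FiniteDimensional ℝ A]
    {H : Type w} [AddCommGroup H] [Module ℝ H] {R : ScScale H} (hR : Good R)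
    (hcR : ∀ m, CompleteSpace (Lev R hR m))
    (hden : ∀ m, ∀ x ∈ R.level m, ∀ ε > (0:ℝ), ∃ y, (∀ n, y ∈ R.level n) ∧ R.lnorm m (x - y) < ε)
    {V : Set A} (hV : Convex ℝ V) (hVu : UniqueDiffOn ℝ V) (k : ℕ) :
    ∀ {E : Type u} {F : Type v} [AddCommGroup E] [Module ℝ E] [AddCommGroup F] [Module ℝ F]
      {S : ScScale E} {hS : Good S} {T : ScScale F} (_hT : Good T)
      {U : Set E} {Φ : E → F} {α : A → E} {l : H →ₗ[ℝ] E} {pr : F →ₗ[ℝ] H} {δ : A → H},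
      Prob S hS T R V k U Φ α l pr δ → ∀ m, Ck R hR V m k δ := by
  induction k with
  | zero => intro E F _ _ _ _ S hS T hT U Φ α l pr δ P m; exact P.cont hT m
  | succ k ih =>
    intro E F _ _ _ _ S hS T hT U Φ α l pr δ P m
    obtain ⟨-, DΦ, h1, hk⟩ := P.sck
    obtain ⟨α', hα'⟩ := ck_der hVu P.ha
    have hδ := ih hT P.mono
    obtain ⟨ε0, e0, hsol⟩ := P.solve hT hR hcR hden h1 hα' 0
    choose! Y hY using fun x hx => (hsol x hx).1
    have hx : ∀ b m, Ck R hR V m k (fun x => (Y x b).v) := fun b => by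
      have hn := P.next hT hR hcR hden h1 hk hα' hδ b (fun x => (Y x b).v)
        ⟨ε0, e0, fun x hx => ⟨(Y x b).mem, hY x hx b⟩⟩
      exact ih hT.tangent hn
    obtain ⟨ε1, e1, hder⟩ := P.der0 hT hR hcR hV hden h1 hα'
    let B := Module.finBasis ℝ A
    choose εi ei gi hgi hgc using fun i => hx (B i) m
    obtain ⟨ε2, e2, le2⟩ := exists_common εi ei
    obtain ⟨ε3, e3, hlev⟩ := P.lev hR m 1 one_pos
    obtain ⟨ε, e, le⟩ := exists_common ![ε0, ε1, ε2, ε3] (by intro i; fin_cases i <;> assumption)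
    have s0 : Vb V ε ⊆ Vb V ε0 := Vb_mono (le 0)
    have s1 : Vb V ε ⊆ Vb V ε1 := Vb_mono (le 1)
    have s2 : ∀ i, Vb V ε ⊆ Vb V (εi i) := fun i => Vb_mono ((le 2).trans (le2 i))
    have s3 : Vb V ε ⊆ Vb V ε3 := Vb_mono (le 3)
    let G' : A → A →L[ℝ] Lev R hR m := fun x => ∑ i,
      ContinuousLinearMap.smulRightL ℝ A (Lev R hR m) (LinearMap.toContinuousLinearMap (B.coord i)) (gi i x)
    have hG'c : ContDiffOn ℝ k G' (Vb V ε) := by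
      refine ContDiffOn.sum fun i _ => ?_
      exact (ContinuousLinearMap.contDiff _).comp_contDiffOn ((hgc i).mono (s2 i))
    have hG' : ∀ x ∈ Vb V ε, (incl hR (Nat.zero_le m)).comp (G' x) = Y x := by
      intro x hx
      ext b
      have h2 : ∀ i, incl hR (Nat.zero_le m) (gi i x) = Y x (B i) := fun i =>
        Lev.ext (by rw [incl_v, hgi i x (s2 i hx)])
      have h3 : incl hR (Nat.zero_le m) (G' x b) = ∑ i, B.repr b i • Y x (B i) := by
        simp [G', map_sum, h2]
      rw [ContinuousLinearMap.comp_apply, h3]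
      conv_rhs => rw [← B.sum_repr b]
      simp only [map_sum, map_smul]
    have hd : ∀ x ∈ Vb V ε, HasFDerivWithinAt (fun x => toLev hR m (δ x)) (G' x) (Vb V ε) x := by
      have := hcR m
      have := hcR 0
      refine lift_deriv (incl hR (Nat.zero_le m)) (incl_inj _) (Vb_convex hV ε)
        hG'c.continuousOn fun x hx => ?_
      rw [hG' x hx]
      have hl : ∀ y ∈ Vb V ε, incl hR (Nat.zero_le m) (toLev hR m (δ y)) = toLev hR 0 (δ y) := by
        intro y hy
        have := (hlev y (s3 hy)).2.1
        exact Lev.ext (by rw [incl_v, toLev_v this, toLev_v (hR.nest (Nat.zero_le m) this)])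
      exact ((hder x (s1 hx) (Y x) (hY x (s0 hx))).mono s1).congr hl (hl x hx)
    refine ⟨ε, e, fun x => toLev hR m (δ x), fun x hx => toLev_v (hlev x (s3 hx)).2.1, ?_⟩
    have := (contDiffOn_succ_iff_hasFDerivWithinAt_of_uniqueDiffOn (n := (k : WithTop ℕ∞))
      (f := fun x => toLev hR m (δ x)) (Vb_unique hVu ε)).2
      ⟨by simp, G', hG'c, hd⟩
    exact_mod_cast this

end GIFT


namespace GIFT
set_option linter.unusedSectionVars false
open Set Filter Topology Asymptotics

theorem lev_complete {E : Type u} [AddCommGroup E] [Module ℝ E] {S : ScScale E}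
    (h : S.IsScBanach) (hS : Good S) (m : ℕ) : CompleteSpace (Lev S hS m) := by
  refine Metric.complete_of_cauchySeq_tendsto fun u hu => ?_
  obtain ⟨x, hx, hlim⟩ := h.2.2.2.2.2.2.1 m (fun k => (u k).v) (fun k => (u k).mem) (by
    intro ε hε
    obtain ⟨K, hK⟩ := Metric.cauchySeq_iff.1 hu ε hε
    refine ⟨K, fun p hp q hq => ?_⟩
    have := hK p hp q hq
    rwa [dist_eq_norm] at this)
  refine ⟨mkL hS x hx, Metric.tendsto_atTop.2 fun ε hε => ?_⟩
  obtain ⟨K, hK⟩ := hlim ε hε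
  refine ⟨K, fun p hp => ?_⟩
  rw [dist_eq_norm]
  exact hK p hp

theorem cone_geom {A : Type v} [NormedAddCommGroup A] [NormedSpace ℝ A] [FiniteDimensional ℝ A]
    {C : Set A} (hC : IsPartialCone C) : Convex ℝ C ∧ UniqueDiffOn ℝ C := by
  obtain ⟨n, k, T, -, rfl⟩ := hC
  have hconv : Convex ℝ {a : A | ∀ i : Fin n, (i : ℕ) < k → 0 ≤ T a i} := by
    intro x hx y hy a b ha hb _ i hi
    have h1 := hx i hi
    have h2 := hy i hi
    simp only [map_add, map_smul, Pi.add_apply, Pi.smul_apply, smul_eq_mul]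
    positivity
  refine ⟨hconv, uniqueDiffOn_convex hconv ⟨T.symm (fun _ => 1), ?_⟩⟩
  have hcont : Continuous T := LinearMap.continuous_of_finiteDimensional T.toLinearMap
  rw [mem_interior]
  refine ⟨⋂ i, {a : A | 0 < T a i}, fun a ha i _ => (mem_iInter.1 ha i).le,
    isOpen_iInter_of_finite fun i => isOpen_lt continuous_const
      ((continuous_apply i).comp hcont), ?_⟩
  simp

/-- Underlying element as a linear map. -/
def vlin {E : Type u} [AddCommGroup E] [Module ℝ E] (S : ScScale E) (hS : Good S) (m : ℕ) :
    Lev S hS m →ₗ[ℝ] E where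
  toFun x := x.v
  map_add' _ _ := rfl
  map_smul' _ _ := rfl

theorem isCk_of_contDiffOn {A : Type v} {E : Type u} [NormedAddCommGroup A] [NormedSpace ℝ A]
    [AddCommGroup E] [Module ℝ E] {S : ScScale E} {hS : Good S} {m k : ℕ} {W : Set A}
    (hW : UniqueDiffOn ℝ W) {g : A → Lev S hS m} (hg : ContDiffOn ℝ k g W) {δ : A → E}
    (hv : ∀ x ∈ W, (g x).v = δ x) : IsCkOnInto S m k W δ := by
  refine ⟨fun j v => (vlin S hS m).compMultilinearMap
    (iteratedFDerivWithin ℝ j g W v).toMultilinearMap, ?_, ?_, ?_, ?_⟩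
  · intro v hvW
    rw [← hv v hvW]
    exact congrArg Lev.v (iteratedFDerivWithin_zero_apply _)
  · intro j _ v _
    refine ⟨fun w => Lev.mem (iteratedFDerivWithin ℝ j g W v w),
      ‖iteratedFDerivWithin ℝ j g W v‖, fun w => ?_⟩
    exact (iteratedFDerivWithin ℝ j g W v).le_opNorm w
  · intro j hj v hvW ε hε
    have hd := (hg.differentiableOn_iteratedFDerivWithin (m := j) (by exact_mod_cast hj) hW
      v hvW).hasFDerivWithinAt.isLittleO
    have h2 := Asymptotics.isLittleO_iff.1 hd hε
    obtain ⟨r, hr, h3⟩ := Metric.mem_nhdsWithin_iff.1 h2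
    refine ⟨r, hr, fun h hh hlt w => ?_⟩
    have h4 := h3 (show v + h ∈ Metric.ball v r ∩ W from ⟨by simpa [dist_eq_norm] using hlt, hh⟩)
    rw [mem_ofPred_eq, add_sub_cancel_left] at h4
    have h5 := ContinuousMultilinearMap.le_of_opNorm_le h4 w
    have h6 : iteratedFDerivWithin ℝ (j+1) g W v (Fin.cons h w : Fin (j+1) → A)
        = fderivWithin ℝ (iteratedFDerivWithin ℝ j g W) W v h w := by
      rw [iteratedFDerivWithin_succ_apply_left]
      simp
    have h7 : S.lnorm m ((iteratedFDerivWithin ℝ j g W (v + h) w).v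
      - (iteratedFDerivWithin ℝ j g W v w).v
      - (fderivWithin ℝ (iteratedFDerivWithin ℝ j g W) W v h w).v) ≤ ε * ‖h‖ * ∏ i, ‖w i‖ := h5
    rw [← h6] at h7
    exact h7
  · intro v hvW ε hε
    have hc := hg.continuousOn_iteratedFDerivWithin (m := k) le_rfl hW v hvW
    obtain ⟨r, hr, h⟩ := Metric.continuousWithinAt_iff.1 hc ε hε
    refine ⟨r, hr, fun v' hv' hlt w => ?_⟩
    have h1 := h hv' (by rwa [dist_eq_norm])
    rw [dist_eq_norm] at h1
    exact ContinuousMultilinearMap.le_of_opNorm_le h1.le w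

end GIFT
open GIFT Set Filter Topology

theorem germ_implicit_function_theorem {A : Type v} {E : Type u}
    [NormedAddCommGroup A] [NormedSpace ℝ A] [FiniteDimensional ℝ A]
    [AddCommGroup E] [Module ℝ E]
    (SE : ScScale E) (hSE : SE.IsScBanach)
    (C V : Set A) (hC : IsPartialCone C) (hVC : V ⊆ C)
    (hVopen : ∃ O : Set A, IsOpen O ∧ V = O ∩ C) (h0V : (0:A) ∈ V)
    (B : A → E → E) (hB00 : B 0 0 = 0)
    -- on every level, near 0, B preserves the level:
    (hBlevel : ∀ m : ℕ, ∃ ε > (0:ℝ), ∀ v ∈ V, ‖v‖ < ε →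
      ∀ u ∈ SE.level m, SE.lnorm m u < ε → B v u ∈ SE.level m)
    -- the contraction property on every level near 0:
    (hBcontr : ∀ m : ℕ, ∃ Θ : ℝ, Θ ∈ Set.Ioo (0:ℝ) 1 ∧ ∃ ε > (0:ℝ),
      ∀ v ∈ V, ‖v‖ < ε → ∀ u ∈ SE.level m, ∀ u' ∈ SE.level m,
        SE.lnorm m u < ε → SE.lnorm m u' < ε →
          SE.lnorm m (B v u - B v u') ≤ Θ * SE.lnorm m (u - u')) :
    -- the germ f(v,u) = u - B(v,u) is sc-smooth near 0:
    ∀ hsmooth : ∀ k : ℕ, ∃ ε > (0:ℝ),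
      IsSck k ((constScale A).prod SE) SE
        {p : A × E | p.1 ∈ V ∧ ‖p.1‖ < ε ∧ p.2 ∈ SE.level 0 ∧ SE.lnorm 0 p.2 < ε}
        (fun p => p.2 - B p.1 p.2),
    -- then the solution germ δ is sc-smooth:
    ∃ δfn : A → E,
      (∀ m : ℕ, ∃ ε > (0:ℝ), ∃ ρ > (0:ℝ), ∀ v ∈ V, ‖v‖ < ε →
        δfn v ∈ SE.level m ∧ SE.lnorm m (δfn v) < ρ ∧ B v (δfn v) = δfn v ∧
        ∀ u ∈ SE.level m, SE.lnorm m u < ρ → B v u = u → u = δfn v) ∧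
      (∀ m k : ℕ, ∃ ε > (0:ℝ),
        (∀ v ∈ V, ‖v‖ < ε → δfn v ∈ SE.level m) ∧
        IsCkOnInto SE m k {v ∈ V | ‖v‖ < ε} δfn) := by
  intro hsmooth
  have hR : Good SE := good_of_banach hSE
  have hcR := fun m => lev_complete hSE hR m
  have hden := hSE.2.2.2.2.2.2.2.2
  -- local fixed points on every level
  have fp : ∀ m : ℕ, ∃ r > (0:ℝ), (∃ ε > (0:ℝ), ∀ v ∈ V, ‖v‖ < ε → ∀ u ∈ SE.level m,
      ∀ u' ∈ SE.level m, SE.lnorm m u < r → SE.lnorm m u' < r → B v u = u → B v u' = u' →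
        u = u') ∧
      ∀ ρ, 0 < ρ → ρ ≤ r → ∃ ε > (0:ℝ), ∀ v ∈ V, ‖v‖ < ε →
        ∃ u ∈ SE.level m, SE.lnorm m u < ρ ∧ B v u = u := by
    intro m
    obtain ⟨Θ, hΘ, ε1, e1, hc⟩ := hBcontr m
    obtain ⟨ε2, e2, hl⟩ := hBlevel m
    obtain ⟨ε3, e3, hs⟩ := hsmooth 0
    refine ⟨min ε1 ε2, by positivity, ⟨ε1, e1, ?_⟩, ?_⟩
    · intro v hv hvε u hu u' hu' hun hun' hfu hfu'
      have := hc v hv hvε u hu u' hu' (hun.trans_le (min_le_left _ _))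
        (hun'.trans_le (min_le_left _ _))
      rw [hfu, hfu'] at this
      refine sub_eq_zero.1 (hR.defi m _ (sub_mem hu hu') ?_)
      nlinarith [hR.nonneg m (u - u'), hΘ.2]
    · intro ρ hρ hρr
      have hρ1 : ρ ≤ ε1 := hρr.trans (min_le_left _ _)
      have hρ2 : ρ ≤ ε2 := hρr.trans (min_le_right _ _)
      have z1 : (1 - Θ) * (ρ / 2) > 0 := mul_pos (by linarith [hΘ.2]) (by positivity)
      obtain ⟨η, hη, hcont⟩ := (hs m).2 (0, 0)
        ⟨⟨h0V, by simpa using e3, zero_mem _, by simpa [lnorm_zero hR] using e3⟩,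
          Submodule.mem_top, zero_mem _⟩ ((1 - Θ) * (ρ / 2)) z1
      refine ⟨min (min ε1 ε2) (min ε3 η), by positivity, fun v hv hvε => ?_⟩
      have v1 : ‖v‖ < ε1 := hvε.trans_le ((min_le_left _ _).trans (min_le_left _ _))
      have v2 : ‖v‖ < ε2 := hvε.trans_le ((min_le_left _ _).trans (min_le_right _ _))
      have v3 : ‖v‖ < ε3 := hvε.trans_le ((min_le_right _ _).trans (min_le_left _ _))
      have v4 : ‖v‖ < η := hvε.trans_le ((min_le_right _ _).trans (min_le_right _ _))
      have hB0 : SE.lnorm m (-B v 0) < (1 - Θ) * (ρ / 2) := by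
        have := hcont (v, 0) ⟨⟨hv, v3, zero_mem _, by simpa [lnorm_zero hR] using e3⟩,
          Submodule.mem_top, zero_mem _⟩ (by
            simpa [ScScale.prod, constScale, lnorm_zero hR] using v4)
        simpa [hB00] using this
      have := hcR m
      let β : Lev SE hR m → Lev SE hR m := fun u => toLev hR m (B v u.v)
      have hβv : ∀ u : Lev SE hR m, ‖u‖ ≤ ρ / 2 → (β u).v = B v u.v := fun u hu =>
        toLev_v (hl v hv v2 u.v u.mem
          (by rw [Lev.norm_def] at hu; linarith))
      have hlip : ∀ u u' : Lev SE hR m, ‖u‖ ≤ ρ / 2 → ‖u'‖ ≤ ρ / 2 →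
          ‖β u - β u'‖ ≤ Θ * ‖u - u'‖ := fun u u' hu hu' => by
        have := hc v hv v1 u.v u.mem u'.v u'.mem
          (by rw [Lev.norm_def] at hu; linarith) (by rw [Lev.norm_def] at hu'; linarith)
        rw [Lev.norm_def, Lev.v_sub, hβv u hu, hβv u' hu']
        exact this
      have n0 : ‖(0 : Lev SE hR m)‖ ≤ ρ / 2 := by rw [norm_zero]; positivity
      have hβ0 : ‖β 0‖ < (1 - Θ) * (ρ / 2) := by
        rw [← norm_neg, Lev.norm_def, Lev.v_neg, hβv 0 n0]
        exact hB0
      have hmaps : MapsTo β (Metric.closedBall 0 (ρ / 2)) (Metric.closedBall 0 (ρ / 2)) := by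
        intro u hu
        rw [mem_closedBall_zero_iff] at hu ⊢
        have h1 := hlip u 0 hu n0
        rw [sub_zero] at h1
        have h2 : ‖β u‖ ≤ ‖β u - β 0‖ + ‖β 0‖ := by
          have := norm_add_le (β u - β 0) (β 0)
          rwa [sub_add_cancel] at this
        nlinarith [hΘ.1]
      obtain ⟨y, hy, hfix, -⟩ := ContractingWith.exists_fixedPoint' (K := ⟨Θ, hΘ.1.le⟩)
        (Metric.isClosed_closedBall.isComplete) hmaps
        ⟨by exact_mod_cast hΘ.2, LipschitzWith.of_dist_le_mul fun p q => by
          have := hlip p.1 q.1 (mem_closedBall_zero_iff.1 p.2) (mem_closedBall_zero_iff.1 q.2)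
          rw [← dist_eq_norm, ← dist_eq_norm] at this
          exact this⟩
        (Metric.mem_closedBall_self (by positivity)) (edist_ne_top _ _)
      rw [mem_closedBall_zero_iff] at hy
      refine ⟨y.v, y.mem, ?_, ?_⟩
      · rw [Lev.norm_def] at hy
        linarith
      · rw [← hβv y hy]
        exact congrArg Lev.v hfix
  obtain ⟨r0, hr0, ⟨εu, eu, huniq⟩, hex⟩ := fp 0
  obtain ⟨ε0, e0, hδ0⟩ := hex r0 hr0 le_rfl
  choose! δ hδl hδn hδf using hδ0
  -- the solution on every level
  have hD : ∀ m : ℕ, ∀ ρ > (0:ℝ), ∃ ε > (0:ℝ), ∀ v ∈ V, ‖v‖ < ε →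
      δ v ∈ SE.level m ∧ SE.lnorm m (δ v) < ρ ∧ B v (δ v) = δ v := by
    intro m ρ hρ
    obtain ⟨r, hr, -, hexm⟩ := fp m
    obtain ⟨c, hc, hcb⟩ := hR.bdd 0 m (Nat.zero_le m)
    obtain ⟨ε1, e1, h1⟩ := hexm (min (min ρ r) (r0 / c)) (by positivity)
      ((min_le_left _ _).trans (min_le_right _ _))
    refine ⟨min ε1 (min ε0 εu), by positivity, fun v hv hvε => ?_⟩
    have v1 : ‖v‖ < ε1 := hvε.trans_le (min_le_left _ _)
    have v0 : ‖v‖ < ε0 := hvε.trans_le ((min_le_right _ _).trans (min_le_left _ _))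
    have vu : ‖v‖ < εu := hvε.trans_le ((min_le_right _ _).trans (min_le_right _ _))
    obtain ⟨u, hu, hun, hfu⟩ := h1 v hv v1
    have hu0 : SE.lnorm 0 u < r0 := by
      have h2 := hun.trans_le (min_le_right _ _)
      rw [lt_div_iff₀ hc] at h2
      have := hcb u hu
      linarith
    have : u = δ v := huniq v hv vu u (hR.nest (Nat.zero_le m) hu) (δ v) (hδl v hv v0) hu0
      (hδn v hv v0) hfu (hδf v hv v0)
    subst this
    exact ⟨hu, hun.trans_le ((min_le_left _ _).trans (min_le_left _ _)), hfu⟩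
  have hδ00 : δ 0 = 0 := by
    refine huniq 0 h0V (by simpa using eu) (δ 0) (hδl 0 h0V (by simpa using e0)) 0 (zero_mem _)
      (hδn 0 h0V (by simpa using e0)) (by simpa [lnorm_zero hR] using hr0)
      (hδf 0 h0V (by simpa using e0)) hB00
  refine ⟨δ, fun m => ?_, fun m k => ?_⟩
  · obtain ⟨r, hr, ⟨ε1, e1, hu⟩, -⟩ := fp m
    obtain ⟨ε2, e2, h2⟩ := hD m r hr
    refine ⟨min ε1 ε2, by positivity, r, hr, fun v hv hvε => ?_⟩
    obtain ⟨a1, a2, a3⟩ := h2 v hv (hvε.trans_le (min_le_right _ _))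
    exact ⟨a1, a2, a3, fun u hul hun hfu => hu v hv (hvε.trans_le (min_le_left _ _)) u hul (δ v) a1
      hun a2 hfu a3⟩
  -- geometry of the parameter set
  obtain ⟨O, hO, hVO⟩ := hVopen
  obtain ⟨hCc, hCu⟩ := cone_geom hC
  have h0O : (0:A) ∈ O := by rw [hVO] at h0V; exact h0V.1
  obtain ⟨r, hr, hrO⟩ := Metric.isOpen_iff.1 hO 0 h0O
  let W : Set A := C ∩ Metric.ball 0 r
  have hWV : W ⊆ V := fun x hx => by rw [hVO]; exact ⟨hrO hx.2, hx.1⟩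
  have hWc : Convex ℝ W := hCc.inter (convex_ball _ _)
  have hWu : UniqueDiffOn ℝ W := hCu.inter Metric.isOpen_ball
  have hVW : ∀ x ∈ V, ‖x‖ < r → x ∈ W := fun x hx hn => ⟨hVC hx, by simpa using hn⟩
  have nrm : ∀ {x : A} {ε : ℝ}, x ∈ Vb W ε → ‖x‖ < ε := fun h => by simpa using h.2
  have hS : Good ((constScale A).prod SE) := (good_const A).prod hR
  obtain ⟨εs, es, hsck⟩ := hsmooth k
  have P : Prob ((constScale A).prod SE) hS SE SE W k
      {p : A × E | p.1 ∈ V ∧ ‖p.1‖ < εs ∧ p.2 ∈ SE.level 0 ∧ SE.lnorm 0 p.2 < εs}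
      (fun p => p.2 - B p.1 p.2) (fun v => (v, 0)) (LinearMap.inr ℝ A E) LinearMap.id δ := by
    refine ⟨hVW 0 h0V (by simpa using hr), hsck, ?_, ?_, fun m => lb_id hR le_rfl, ?_, ?_, ?_⟩
    · intro m
      let L : A →ₗ[ℝ] Lev ((constScale A).prod SE) hS m :=
        { toFun := fun v => mkL hS (v, 0) ⟨Submodule.mem_top, zero_mem _⟩
          map_add' := fun x y => Lev.ext (show (x + y, (0:E)) = (x, 0) + (y, 0) by simp)
          map_smul' := fun c x => Lev.ext (show (c • x, (0:E)) = c • (x, 0) by simp) }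
      exact ⟨1, one_pos, L, fun x _ => rfl,
        (LinearMap.toContinuousLinearMap L).contDiff.contDiffOn⟩
    · intro m
      refine ⟨fun x hx => ⟨Submodule.mem_top, hx⟩, 1, fun x hx => ?_⟩
      simp [ScScale.prod, constScale]
    · refine ⟨εs, es, fun x hx y hy hyn => ?_⟩
      rw [hδ00, sub_zero] at hyn
      simpa using ⟨hWV hx.1, nrm hx, hy, hyn⟩
    · intro m
      obtain ⟨Θ, hΘ, ε1, e1, hc⟩ := hBcontr m
      refine ⟨Θ, hΘ.1.le, hΘ.2, ε1, e1, fun x hx y hy y' hy' hyn hyn' => ?_⟩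
      rw [hδ00, sub_zero] at hyn hyn'
      have := hc x (hWV hx.1) (nrm hx) y hy y' hy' hyn hyn'
      have e : y - y' - (y - B x y - (y' - B x y')) = B x y - B x y' := by abel
      simpa [e] using this
    · intro m ρ hρ
      obtain ⟨ε1, e1, h1⟩ := hD m ρ hρ
      refine ⟨ε1, e1, fun x hx => ?_⟩
      obtain ⟨a1, a2, a3⟩ := h1 x (hWV hx.1) (nrm hx)
      refine ⟨a1, by rwa [hδ00, sub_zero], ?_⟩
      simp [a3]
  obtain ⟨ε1, e1, g, hg, hgc⟩ := main_ck hR hcR hden hWc hWu k hR P m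
  have hset : {v ∈ V | ‖v‖ < min ε1 r} = Vb W (min ε1 r) := by
    ext x
    constructor
    · rintro ⟨h1, h2⟩
      exact ⟨hVW x h1 (h2.trans_le (min_le_right _ _)), by simpa using h2⟩
    · intro hx
      exact ⟨hWV hx.1, nrm hx⟩
  have hsub : Vb W (min ε1 r) ⊆ Vb W ε1 := Vb_mono (min_le_left _ _)
  refine ⟨min ε1 r, by positivity, fun v hv hvε => ?_, ?_⟩
  · have : v ∈ Vb W (min ε1 r) := by rw [← hset]; exact ⟨hv, hvε⟩
    rw [← hg v (hsub this)]
    exact (g v).mem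
  · rw [hset]
    exact isCk_of_contDiffOn (Vb_unique hWu _) (hgc.mono hsub) fun x hx => hg x (hsub hx)
end
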